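/- arXiv:2207.14368 — 11 statements merged into one kernel-verified Lean document; each statement's English description precedes it below -/
import Mathlib

section
/- Let n ≥ 1 and let 𝓕_1, …, 𝓕_{n+1} be nonempty families of closed intervals [a,b] (a ≤ b) in ℝ such that every colorful (n+1)-tuple (I_1, …, I_{n+1}) with I_i ∈ 𝓕_i is n-pierceable. Then there exists i ∈ {1,…,n+1} such that the family 𝓕_i is n-pierceable. -/
/-- A family `𝓕` of subsets of `X` is `n`-pierceable if there is a set of at most `n`
points meeting every member of `𝓕`. -/
def Pierceable {X : Type*} (n : ℕ) (𝓕 : Set (Set X)) : Prop :=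
  ∃ P : Finset X, P.card ≤ n ∧ ∀ F ∈ 𝓕, ∃ p ∈ P, p ∈ F

/-- Greedy rainbow selection: for `T.card` many sets of intervals (encoded by their endpoints),
none of which can be pierced by fewer than `T.card` points, one can choose one interval from each
set such that the chosen intervals are pairwise separated. -/
theorem exists_rainbow_separated {ι : Type*} [DecidableEq ι] (n : ℕ) (T : Finset ι)
    (hT : T.card = n) (S : ι → Set (ℝ × ℝ))
    (hS : ∀ i ∈ T, ∀ P : Finset ℝ, P.card < n → ∃ x ∈ S i, ∀ p ∈ P, ¬ (x.1 ≤ p ∧ p ≤ x.2)) :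
    ∃ f : ι → ℝ × ℝ, (∀ i ∈ T, f i ∈ S i) ∧
      ∀ i ∈ T, ∀ j ∈ T, i ≠ j → (f i).2 < (f j).1 ∨ (f j).2 < (f i).1 := by
  induction n generalizing T S with
  | zero =>
    obtain rfl := Finset.card_eq_zero.mp hT
    exact ⟨fun _ => 0, by simp, by simp⟩
  | succ n ih =>
    have hne : ∀ i ∈ T, (S i).Nonempty := fun i hi => by
      obtain ⟨x, hx, -⟩ := hS i hi ∅ (by simp)
      exact ⟨x, hx⟩
    have hTne : T.Nonempty := Finset.card_pos.mp (by omega)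
    obtain ⟨i, hi, hfirst⟩ : ∃ i ∈ T, ∀ k ∈ T, ∀ P : Finset ℝ, P.card < n →
        ∃ x ∈ {x ∈ S k | ∃ y ∈ S i, y.2 < x.1}, ∀ p ∈ P, ¬ (x.1 ≤ p ∧ p ≤ x.2) := by
      by_cases hb : ∀ i ∈ T, BddBelow (Set.image Prod.snd (S i))
      · obtain ⟨i, hi, hmin⟩ := T.exists_min_image (fun i => sInf (Set.image Prod.snd (S i))) hTne
        refine ⟨i, hi, fun k hk P hP => ?_⟩
        set p := sInf (Set.image Prod.snd (S i))
        obtain ⟨x, hx, hxP⟩ := hS k hk (insert p P)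
          ((Finset.card_insert_le p P).trans_lt (by omega))
        have hpx : p ≤ x.2 := (hmin k hk).trans (csInf_le (hb k hk) ⟨x, hx, rfl⟩)
        have hlt : p < x.1 := by
          by_contra! h
          exact hxP p (Finset.mem_insert_self p P) ⟨h, hpx⟩
        obtain ⟨_, ⟨y, hy, rfl⟩, hyx⟩ := exists_lt_of_csInf_lt ((hne i hi).image _) hlt
        exact ⟨x, ⟨hx, y, hy, hyx⟩, fun q hq => hxP q (Finset.mem_insert_of_mem hq)⟩
      · push Not at hb
        obtain ⟨i, hi, hunb⟩ := hb
        refine ⟨i, hi, fun k hk P hP => ?_⟩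
        obtain ⟨x, hx, hxP⟩ := hS k hk P (by omega)
        obtain ⟨_, ⟨y, hy, rfl⟩, hyx⟩ := not_bddBelow_iff.mp hunb x.1
        exact ⟨x, ⟨hx, y, hy, hyx⟩, hxP⟩
    obtain ⟨f, hf, hsep⟩ := ih (T.erase i) (by rw [Finset.card_erase_of_mem hi]; omega)
      (fun k => {x ∈ S k | ∃ y ∈ S i, y.2 < x.1})
      (fun k hk => hfirst k (Finset.mem_of_mem_erase hk))
    obtain ⟨y, hy, hyf⟩ : ∃ y ∈ S i, ∀ k ∈ T.erase i, y.2 < (f k).1 := by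
      rcases (T.erase i).eq_empty_or_nonempty with he | he
      · obtain ⟨y, hy⟩ := hne i hi
        exact ⟨y, hy, by simp [he]⟩
      · obtain ⟨k, hk, hmin⟩ := (T.erase i).exists_min_image (fun k => (f k).1) he
        obtain ⟨-, y, hy, hyk⟩ := hf k hk
        exact ⟨y, hy, fun l hl => hyk.trans_le (hmin l hl)⟩
    refine ⟨Function.update f i y, fun k hk => ?_, fun k hk l hl hkl => ?_⟩
    · rcases eq_or_ne k i with rfl | hki
      · simpa using hy
      · simpa [hki] using (hf k (Finset.mem_erase.mpr ⟨hki, hk⟩)).1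
    · rcases eq_or_ne k i with rfl | hki
      · simpa [hkl.symm] using Or.inl (hyf l (Finset.mem_erase.mpr ⟨hkl.symm, hl⟩))
      · rcases eq_or_ne l i with rfl | hli
        · simpa [hkl] using Or.inr (hyf k (Finset.mem_erase.mpr ⟨hkl, hk⟩))
        · simpa [hki, hli] using hsep k (Finset.mem_erase.mpr ⟨hki, hk⟩) l
            (Finset.mem_erase.mpr ⟨hli, hl⟩) hkl

/-- Colorful Helly theorem for `n`-piercing of closed intervals on the line:
if every colorful `(n+1)`-tuple from the nonempty families `𝓕 0, …, 𝓕 n` of closed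
intervals is `n`-pierceable, then some family `𝓕 i` is `n`-pierceable. -/
theorem colorful_helly_intervals (n : ℕ) (hn : 1 ≤ n)
    (𝓕 : Fin (n + 1) → Set (Set ℝ))
    (hne : ∀ i, (𝓕 i).Nonempty)
    (hIcc : ∀ i, ∀ I ∈ 𝓕 i, ∃ a b : ℝ, a ≤ b ∧ I = Set.Icc a b)
    (hcol : ∀ f : Fin (n + 1) → Set ℝ, (∀ i, f i ∈ 𝓕 i) →
      Pierceable n {I | ∃ i, I = f i}) :
    ∃ i, Pierceable n (𝓕 i) := by
  by_contra! hnot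
  obtain ⟨f, hf, hsep⟩ := exists_rainbow_separated (n + 1) (Finset.univ : Finset (Fin (n + 1)))
    (by simp) (fun i => {x | Set.Icc x.1 x.2 ∈ 𝓕 i}) (fun i _ P hP => by
      by_contra! h
      refine hnot i ⟨P, by omega, fun I hI => ?_⟩
      obtain ⟨a, b, -, rfl⟩ := hIcc i I hI
      exact h (a, b) hI)
  obtain ⟨P, hP, hpierce⟩ := hcol (fun i => Set.Icc (f i).1 (f i).2)
    (fun i => hf i (Finset.mem_univ i))
  choose p hpP hp using fun i => hpierce _ ⟨i, rfl⟩
  have hinj : Function.Injective p := fun i j hij => by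
    by_contra hij_ne
    have hi := hp i
    have hj := hp j
    rw [← hij] at hj
    rcases hsep i (Finset.mem_univ i) j (Finset.mem_univ j) hij_ne with h | h
    · exact absurd (hj.1.trans hi.2) h.not_ge
    · exact absurd (hi.1.trans hj.2) h.not_ge
  have hcard := Finset.card_le_card_of_injOn (s := Finset.univ) p (fun i _ => hpP i) hinj.injOn
  simp only [Finset.card_univ, Fintype.card_fin] at hcard
  omega
end

section
/- Let n ≥ 1 and let 𝓕_1, …, 𝓕_{n+1} be nonempty families of closed intervals [a,b] (a ≤ b) in ℝ such that every colorful (n+1)-tuple (I_1, …, I_{n+1}) with I_i ∈ 𝓕_i is n-pierceable. Then there exists i ∈ {1,…,n+1} and, for every k ∈ {1,…,n+1} with k ≠ i, an interval F_k ∈ 𝓕_k, such that the family 𝓕_i ∪ {F_k : k ∈ {1,…,n+1}, k ≠ i} is n-pierceable. -/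
/-- Among finitely many nonempty families of intervals `[I.1, I.2]` there is a leftmost one `F j`:
for every `i`, some point of some member of `F j` pierces all those members of `F i` that do not
lie strictly to the right of any member of `F j`. -/
theorem exists_leftmost_interval_family {ι : Type*} (s : Finset ι) (hs : s.Nonempty)
    (F : ι → Set (ℝ × ℝ)) (hne : ∀ i ∈ s, (F i).Nonempty)
    (hle : ∀ i ∈ s, ∀ I ∈ F i, I.1 ≤ I.2) :
    ∃ j ∈ s, ∀ i ∈ s, ∃ I ∈ F j, ∃ p, p ∈ Set.Icc I.1 I.2 ∧
      ∀ C ∈ F i, (∀ I' ∈ F j, C.1 ≤ I'.2) → p ∈ Set.Icc C.1 C.2 := by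
  classical
  let R : ι → Set ℝ := fun i => {x | ∃ I ∈ F i, I.2 ≤ x}
  have hsub : ∀ i j, (∃ x ∈ R j, x ∉ R i) → R i ⊆ R j := by
    rintro i j ⟨x, ⟨I, hI, hIx⟩, hx⟩ y ⟨K, hK, hKy⟩
    refine ⟨I, hI, ?_⟩
    by_contra! h
    exact hx ⟨K, hK, by linarith⟩
  obtain ⟨m, hm⟩ := s.exists_maximalFor R hs
  have hmax : ∀ i ∈ s, R i ⊆ R m := by
    intro i hi
    by_contra h
    obtain ⟨x, hx, hxm⟩ := Set.not_subset.1 h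
    exact h (hm.2 hi (hsub m i ⟨x, hx, hxm⟩))
  -- The ties for leftmost are broken in favour of a family with a member reaching below `R m`.
  obtain ⟨j, hj, hRj, hgood⟩ : ∃ j ∈ s, R j = R m ∧
      ((∃ i ∈ s, R i = R m ∧ ∃ I ∈ F i, ∀ x ∈ R m, I.1 ≤ x) →
        ∃ I ∈ F j, ∀ x ∈ R m, I.1 ≤ x) := by
    by_cases h : ∃ i ∈ s, R i = R m ∧ ∃ I ∈ F i, ∀ x ∈ R m, I.1 ≤ x
    · obtain ⟨i, hi, hRi, hI⟩ := h
      exact ⟨i, hi, hRi, fun _ => hI⟩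
    · exact ⟨m, hm.1, rfl, fun h' => absurd h' h⟩
  refine ⟨j, hj, fun i hi => ?_⟩
  have hmem : ∀ k, ∀ C ∈ F k, C.2 ∈ R k := fun k C hC => ⟨C, hC, le_rfl⟩
  have hlow : ∀ C : ℝ × ℝ, (∀ I' ∈ F j, C.1 ≤ I'.2) → ∀ x ∈ R m, C.1 ≤ x := by
    rintro C hC x hx
    rw [← hRj] at hx
    obtain ⟨I, hI, hIx⟩ := hx
    exact (hC I hI).trans hIx
  by_cases hRi : R i = R m
  · by_cases hC : ∃ C ∈ F i, ∀ I' ∈ F j, C.1 ≤ I'.2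
    · obtain ⟨C, hC, hCl⟩ := hC
      obtain ⟨I, hI, hIl⟩ := hgood ⟨i, hi, hRi, C, hC, hlow C hCl⟩
      have hbdd : BddBelow (R m) := ⟨I.1, hIl⟩
      have hRne : (R m).Nonempty := ⟨I.2, hRj ▸ hmem j I hI⟩
      exact ⟨I, hI, sInf (R m),
        ⟨le_csInf hRne hIl, csInf_le hbdd (hRj ▸ hmem j I hI)⟩,
        fun D hD hDl => ⟨le_csInf hRne (hlow D hDl), csInf_le hbdd (hRi ▸ hmem i D hD)⟩⟩
    · obtain ⟨I, hI⟩ := hne j hj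
      exact ⟨I, hI, I.1, ⟨le_rfl, hle j hj I hI⟩, fun C hC' hl => absurd ⟨C, hC', hl⟩ hC⟩
  · obtain ⟨x, hx, hxi⟩ := Set.not_subset.1 fun h => hRi ((hmax i hi).antisymm h)
    rw [← hRj] at hx
    obtain ⟨I, hI, hIx⟩ := hx
    refine ⟨I, hI, I.2, ⟨hle j hj I hI, le_rfl⟩, fun C hC hl => ⟨hl I hI, ?_⟩⟩
    by_contra! h
    exact hxi ⟨C, hC, by linarith⟩

/-- If `n + 1` nonempty families of intervals `[I.1, I.2]` admit no pairwise disjoint colorful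
selection, then one of them, together with one interval from each other family, is pierced by `n`
points. -/
theorem exists_piercing_of_no_disjoint_selection {ι : Type*} (n : ℕ) :
    ∀ (s : Finset ι) (F : ι → Set (ℝ × ℝ)), s.card = n + 1 → (∀ i ∈ s, (F i).Nonempty) →
    (∀ i ∈ s, ∀ I ∈ F i, I.1 ≤ I.2) →
    (¬ ∃ f : ι → ℝ × ℝ, (∀ i ∈ s, f i ∈ F i) ∧
      (s : Set ι).Pairwise fun i j => (f i).2 < (f j).1 ∨ (f j).2 < (f i).1) →
    ∃ i ∈ s, ∃ f : ι → ℝ × ℝ, ∃ P : Finset ℝ, P.card ≤ n ∧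
      (∀ k ∈ s, k ≠ i → f k ∈ F k ∧ ∃ p ∈ P, p ∈ Set.Icc (f k).1 (f k).2) ∧
      ∀ C ∈ F i, ∃ p ∈ P, p ∈ Set.Icc C.1 C.2 := by
  classical
  induction n with
  | zero =>
    intro s F hs hne _ hno
    obtain ⟨a, rfl⟩ := Finset.card_eq_one.1 hs
    obtain ⟨I, hI⟩ := hne a (by simp)
    exact absurd ⟨fun _ => I, by simpa using hI, by simp⟩ hno
  | succ n ih =>
    intro s F hs hne hle hno
    obtain ⟨j, hj, hlm⟩ :=
      exists_leftmost_interval_family s (Finset.card_pos.1 (by omega)) F hne hle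
    have hcard : (s.erase j).card = n + 1 := by rw [Finset.card_erase_of_mem hj, hs]; rfl
    let G : ι → Set (ℝ × ℝ) := fun i => {C ∈ F i | ∃ I ∈ F j, I.2 < C.1}
    by_cases hG : ∀ i ∈ s.erase j, (G i).Nonempty
    · obtain ⟨i, hi, f, P, hP, hf, hFi⟩ := ih (s.erase j) G hcard hG
        (fun i hi I hI => hle i (Finset.mem_of_mem_erase hi) I hI.1) <| by
          rintro ⟨f, hf, hdisj⟩
          have hleft : ∀ k ∈ s.erase j, ∃ I ∈ F j, I.2 < (f k).1 := fun k hk => (hf k hk).2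
          choose! K hK hKlt using hleft
          obtain ⟨l, hl, hmin⟩ := (s.erase j).exists_min_image (fun k => (K k).2)
            (Finset.card_pos.1 (by omega))
          have hlt : ∀ k ∈ s, k ≠ j → (K l).2 < (f k).1 := fun k hk hkj =>
            (hmin k (Finset.mem_erase.2 ⟨hkj, hk⟩)).trans_lt (hKlt k (Finset.mem_erase.2 ⟨hkj, hk⟩))
          refine hno ⟨Function.update f j (K l), fun k hk => ?_, fun a ha b hb hab => ?_⟩
          · rcases eq_or_ne k j with rfl | hkj
            · simpa using hK l hl
            · simpa [hkj] using (hf k (Finset.mem_erase.2 ⟨hkj, hk⟩)).1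
          · rcases eq_or_ne a j with rfl | haj
            · simpa [hab.symm] using Or.inl (hlt b hb hab.symm)
            · rcases eq_or_ne b j with rfl | hbj
              · simpa [haj] using Or.inr (hlt a ha haj)
              · simpa [haj, hbj] using hdisj (Finset.mem_erase.2 ⟨haj, ha⟩)
                  (Finset.mem_erase.2 ⟨hbj, hb⟩) hab
      obtain ⟨hij, his⟩ := Finset.mem_erase.1 hi
      obtain ⟨I, hI, p, hpI, hp⟩ := hlm i his
      refine ⟨i, his, Function.update f j I, insert p P,
        (Finset.card_insert_le _ _).trans (by omega), fun k hk hki => ?_, fun C hC => ?_⟩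
      · rcases eq_or_ne k j with rfl | hkj
        · simpa using ⟨hI, Or.inl hpI⟩
        · obtain ⟨hkG, q, hq, hqk⟩ := hf k (Finset.mem_erase.2 ⟨hkj, hk⟩) hki
          rw [Function.update_of_ne hkj]
          exact ⟨hkG.1, q, Finset.mem_insert_of_mem hq, hqk⟩
      · by_cases hCG : C ∈ G i
        · obtain ⟨q, hq, hqC⟩ := hFi C hCG
          exact ⟨q, Finset.mem_insert_of_mem hq, hqC⟩
        · refine ⟨p, Finset.mem_insert_self _ _, hp C hC fun I' hI' => ?_⟩
          by_contra! h
          exact hCG ⟨hC, I', hI', h⟩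
    · push Not at hG
      obtain ⟨i, hi, hGi⟩ := hG
      obtain ⟨hij, his⟩ := Finset.mem_erase.1 hi
      obtain ⟨I, hI, p, hpI, hp⟩ := hlm i his
      choose! f hf using hne
      refine ⟨i, his, Function.update f j I,
        insert p (((s.erase j).erase i).image fun k => (f k).1), ?_, fun k hk hki => ?_,
        fun C hC => ⟨p, Finset.mem_insert_self _ _, hp C hC fun I' hI' => ?_⟩⟩
      · refine (Finset.card_insert_le _ _).trans (Nat.succ_le_succ (Finset.card_image_le.trans ?_))
        rw [Finset.card_erase_of_mem hi, hcard]
        rfl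
      · rcases eq_or_ne k j with rfl | hkj
        · simpa using ⟨hI, Or.inl hpI⟩
        · rw [Function.update_of_ne hkj]
          exact ⟨hf k hk, (f k).1, Finset.mem_insert_of_mem (Finset.mem_image_of_mem
            (fun k => (f k).1) (Finset.mem_erase.2 ⟨hki, Finset.mem_erase.2 ⟨hkj, hk⟩⟩)),
            le_rfl, hle k hk _ (hf k hk)⟩
      · by_contra! h
        exact Set.eq_empty_iff_forall_notMem.1 hGi C ⟨hC, I', hI', h⟩

/-- Strong colorful Helly theorem for `n`-piercing of closed intervals on the line:
if every colorful `(n+1)`-tuple from the nonempty families `𝓕 0, …, 𝓕 n` of closed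
intervals is `n`-pierceable, then there is an `i` and a choice of one interval
`F k ∈ 𝓕 k` for every `k ≠ i` such that `𝓕 i` together with these chosen intervals
is `n`-pierceable. -/
theorem strong_colorful_helly_intervals (n : ℕ) (hn : 1 ≤ n)
    (𝓕 : Fin (n + 1) → Set (Set ℝ))
    (hne : ∀ i, (𝓕 i).Nonempty)
    (hIcc : ∀ i, ∀ I ∈ 𝓕 i, ∃ a b : ℝ, a ≤ b ∧ I = Set.Icc a b)
    (hcol : ∀ f : Fin (n + 1) → Set ℝ, (∀ i, f i ∈ 𝓕 i) →
      Pierceable n {I | ∃ i, I = f i}) :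
    ∃ i : Fin (n + 1), ∃ F : Fin (n + 1) → Set ℝ,
      (∀ k, k ≠ i → F k ∈ 𝓕 k) ∧
      Pierceable n (𝓕 i ∪ {I | ∃ k, k ≠ i ∧ I = F k}) := by
  classical
  let G : Fin (n + 1) → Set (ℝ × ℝ) := fun i => {I | I.1 ≤ I.2 ∧ Set.Icc I.1 I.2 ∈ 𝓕 i}
  obtain ⟨i, -, f, P, hP, hf, hFi⟩ := exists_piercing_of_no_disjoint_selection n Finset.univ G
    (by simp)
    (fun i _ => by
      obtain ⟨I, hI⟩ := hne i
      obtain ⟨a, b, hab, rfl⟩ := hIcc i I hI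
      exact ⟨(a, b), hab, hI⟩)
    (fun i _ I hI => hI.1) <| by
      rintro ⟨f, hf, hdisj⟩
      obtain ⟨P, hP, hpierce⟩ :=
        hcol (fun i => Set.Icc (f i).1 (f i).2) fun i => (hf i (Finset.mem_univ i)).2
      choose p hpP hp using fun i => hpierce _ ⟨i, rfl⟩
      obtain ⟨a, -, b, -, hab, heq⟩ := Finset.exists_ne_map_eq_of_card_lt_of_maps_to
        (s := Finset.univ) (t := P) (f := p) (by simpa using Nat.lt_succ_of_le hP)
        (fun i _ => hpP i)
      have ha := hp a
      have hb := hp b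
      rw [← heq] at hb
      rcases hdisj (by simp) (by simp) hab with h | h
      · linarith [ha.2, hb.1]
      · linarith [ha.1, hb.2]
  refine ⟨i, fun k => Set.Icc (f k).1 (f k).2,
    fun k hk => (hf k (Finset.mem_univ k) hk).1.2, P, hP, ?_⟩
  rintro I (hI | ⟨k, hk, rfl⟩)
  · obtain ⟨a, b, hab, rfl⟩ := hIcc i I hI
    exact hFi (a, b) ⟨hab, hI⟩
  · exact (hf k (Finset.mem_univ k) hk).2
end

section
/- Let d ≥ 1 and let 𝓕_1, …, 𝓕_{3d} be nonempty finite families of axis-parallel boxes in ℝ^d such that every colorful 3d-tuple (B_1, …, B_{3d}) with B_i ∈ 𝓕_i is 2-pierceable. Then there exists i ∈ {1,…,3d} such that the family 𝓕_i is 2-pierceable. -/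
/-- `B` is an axis-parallel box in `ℝ^d`. -/
def IsBox {d : ℕ} (B : Set (Fin d → ℝ)) : Prop :=
  ∃ a b : Fin d → ℝ, (∀ j, a j ≤ b j) ∧ B = Set.Icc a b

/-- Greedy selection: one can choose `#K` of the families together with a representative of each
family so that every functional `g t`, `t ∈ K`, has a chosen representative minimizing it against
all members of the families that were not chosen. -/
theorem exists_extremal_transversal {ι κ X : Type*} [Fintype ι] [DecidableEq ι] [DecidableEq κ]
    (𝓕 : ι → Set X) (hfin : ∀ i, (𝓕 i).Finite) (hne : ∀ i, (𝓕 i).Nonempty)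
    (g : κ → X → ℝ) (K : Finset κ) (hK : K.card ≤ Fintype.card ι) :
    ∃ (T : Finset ι) (f : ι → X), T.card = K.card ∧ (∀ i, f i ∈ 𝓕 i) ∧
      ∀ t ∈ K, ∃ i ∈ T, ∀ i' ∉ T, ∀ B ∈ 𝓕 i', g t (f i) ≤ g t B := by
  induction K using Finset.induction_on with
  | empty =>
    choose f hf using hne
    exact ⟨∅, f, rfl, hf, by simp⟩
  | insert t K ht ih =>
    rw [Finset.card_insert_of_notMem ht] at hK
    obtain ⟨T, f, hT, hf, hmin⟩ := ih (by omega)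
    have hTne : ∃ i, i ∉ T := by
      by_contra! h
      have : T = Finset.univ := Finset.eq_univ_iff_forall.2 h
      rw [this, Finset.card_univ] at hT
      omega
    have hUfin : {B | ∃ i ∉ T, B ∈ 𝓕 i}.Finite :=
      (Set.finite_iUnion hfin).subset fun B ⟨i, _, hB⟩ => Set.mem_iUnion.2 ⟨i, hB⟩
    have hUne : {B | ∃ i ∉ T, B ∈ 𝓕 i}.Nonempty := by
      obtain ⟨i, hi⟩ := hTne
      obtain ⟨B, hB⟩ := hne i
      exact ⟨B, i, hi, hB⟩
    obtain ⟨B₀, ⟨i₀, hi₀, hB₀⟩, hB₀min⟩ := Set.exists_min_image _ (g t) hUfin hUne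
    refine ⟨insert i₀ T, Function.update f i₀ B₀, ?_, ?_, ?_⟩
    · rw [Finset.card_insert_of_notMem hi₀, Finset.card_insert_of_notMem ht, hT]
    · intro i
      by_cases h : i = i₀
      · subst h
        simpa using hB₀
      · simpa [h] using hf i
    · intro s hs
      rcases Finset.mem_insert.1 hs with rfl | hs
      · refine ⟨i₀, Finset.mem_insert_self _ _, fun i' hi' B hB => ?_⟩
        rw [Function.update_self]
        exact hB₀min B ⟨i', fun h => hi' (Finset.mem_insert_of_mem h), hB⟩
      · obtain ⟨i, hi, h⟩ := hmin s hs
        refine ⟨i, Finset.mem_insert_of_mem hi, fun i' hi' B hB => ?_⟩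
        rw [Function.update_of_ne (ne_of_mem_of_not_mem hi hi₀)]
        exact h i' (fun h => hi' (Finset.mem_insert_of_mem h)) B hB

/-- A set of Boolean vectors that is an affine subspace over the field with two elements. -/
def IsXorClosed {d : ℕ} (A : Set (Fin d → Bool)) : Prop :=
  ∀ x ∈ A, ∀ y ∈ A, ∀ z ∈ A, (fun j => x j ^^ y j ^^ z j) ∈ A

theorem IsXorClosed.inter {d : ℕ} {A S : Set (Fin d → Bool)} (hA : IsXorClosed A)
    (hS : IsXorClosed S) : IsXorClosed (A ∩ S) :=
  fun x hx y hy z hz => ⟨hA x hx.1 y hy.1 z hz.1, hS x hx.2 y hy.2 z hz.2⟩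

/-- A proper affine subspace over the field with two elements has at most half the points. -/
theorem IsXorClosed.two_mul_ncard_inter_le {d : ℕ} {A S : Set (Fin d → Bool)} (hA : IsXorClosed A)
    (hS : IsXorClosed S) {x : Fin d → Bool} (hxA : x ∈ A) (hxS : x ∉ S) :
    2 * (A ∩ S).ncard ≤ A.ncard := by
  rcases (A ∩ S).eq_empty_or_nonempty with h | ⟨y, hyA, hyS⟩
  · simp [h]
  have hinj : (A ∩ S).ncard ≤ (A \ S).ncard := by
    refine Set.ncard_le_ncard_of_injOn (fun z j => z j ^^ x j ^^ y j) ?_ ?_ (Set.toFinite _)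
    · rintro z ⟨hzA, hzS⟩
      refine ⟨hA z hzA x hxA y hyA, fun h => hxS ?_⟩
      convert hS _ h z hzS y hyS using 1
      funext j
      cases z j <;> cases x j <;> cases y j <;> rfl
    · intro z _ w _ h
      funext j
      have := congrFun h j
      revert this
      dsimp only
      cases z j <;> cases w j <;> cases x j <;> cases y j <;> simp
  have := Set.ncard_inter_add_ncard_sdiff_eq_ncard A S (Set.toFinite _)
  omega

/-- If no vector solves all constraints of a single family, then `#U` families admit a transversal
with at most `2 ^ d / 2 ^ #U` common solutions. -/
theorem exists_transversal_few_solutions {ι X : Type*} [DecidableEq ι] {d : ℕ}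
    (𝓕 : ι → Set X) (hne : ∀ i, (𝓕 i).Nonempty) (S : X → Set (Fin d → Bool))
    (hS : ∀ B, IsXorClosed (S B)) (U : Finset ι) (hU : ∀ i ∈ U, ∀ x, ∃ B ∈ 𝓕 i, x ∉ S B) :
    ∃ f : ι → X, (∀ i, f i ∈ 𝓕 i) ∧ IsXorClosed {x | ∀ i ∈ U, x ∈ S (f i)} ∧
      2 ^ U.card * {x | ∀ i ∈ U, x ∈ S (f i)}.ncard ≤ 2 ^ d := by
  induction U using Finset.induction_on with
  | empty =>
    choose f hf using hne
    exact ⟨f, hf, by simp [IsXorClosed], by simp [Set.ncard_univ]⟩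
  | insert i U hi ih =>
    obtain ⟨f, hf, hcl, hcard⟩ := ih fun i' hi' => hU i' (Finset.mem_insert_of_mem hi')
    have hset : ∀ B, {x | ∀ i' ∈ insert i U, x ∈ S (Function.update f i B i')} =
        {x | ∀ i' ∈ U, x ∈ S (f i')} ∩ S B := by
      intro B
      ext x
      simp only [Finset.forall_mem_insert, Function.update_self, Set.mem_ofPred_eq, Set.mem_inter_iff]
      rw [and_comm]
      refine and_congr_left fun _ => forall₂_congr fun i' hi' => ?_
      rw [Function.update_of_ne (ne_of_mem_of_not_mem hi' hi)]
    obtain ⟨B, hB, hle⟩ : ∃ B ∈ 𝓕 i, 2 * ({x | ∀ i' ∈ U, x ∈ S (f i')} ∩ S B).ncard ≤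
        {x | ∀ i' ∈ U, x ∈ S (f i')}.ncard := by
      rcases {x | ∀ i' ∈ U, x ∈ S (f i')}.eq_empty_or_nonempty with h | ⟨x, hx⟩
      · exact ⟨f i, hf i, by simp [h]⟩
      · obtain ⟨B, hB, hxB⟩ := hU i (Finset.mem_insert_self _ _) x
        exact ⟨B, hB, hcl.two_mul_ncard_inter_le (hS B) hx hxB⟩
    refine ⟨Function.update f i B, fun i' => ?_, ?_, ?_⟩
    · by_cases h : i' = i
      · subst h
        simpa using hB
      · simpa [h] using hf i'
    · rw [hset]
      exact hcl.inter (hS B)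
    · rw [hset, Finset.card_insert_of_notMem hi, pow_succ, mul_assoc]
      exact (Nat.mul_le_mul_left _ hle).trans hcard

/-- The point with coordinate `a j` where `x j` holds or the thresholds are not separated
(`b j ≤ a j`), and `b j` elsewhere. -/
noncomputable def cornerPoint {d : ℕ} (a b : Fin d → ℝ) (x : Fin d → Bool) : Fin d → ℝ :=
  fun j => if x j = true ∨ b j ≤ a j then a j else b j

/-- The sign vectors `x` such that `B` contains the corner given by `x` or the opposite one. -/
def cornerSolutions {d : ℕ} (a b : Fin d → ℝ) (B : Set (Fin d → ℝ)) : Set (Fin d → Bool) :=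
  {x | ∃ s : Bool, cornerPoint a b (fun j => x j ^^ s) ∈ B}

theorem isXorClosed_cornerSolutions {d : ℕ} (a b l r : Fin d → ℝ) :
    IsXorClosed (cornerSolutions a b (Set.Icc l r)) := by
  rintro x ⟨s, hs⟩ y ⟨t, ht⟩ z ⟨u, hu⟩
  refine ⟨s ^^ t ^^ u, ?_⟩
  have key : ∀ j, cornerPoint a b (fun j => (x j ^^ y j ^^ z j) ^^ (s ^^ t ^^ u)) j
      ∈ Set.Icc (l j) (r j) := by
    intro j
    have hx : _ ∈ Set.Icc (l j) (r j) := ⟨hs.1 j, hs.2 j⟩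
    have hy : _ ∈ Set.Icc (l j) (r j) := ⟨ht.1 j, ht.2 j⟩
    have hz : _ ∈ Set.Icc (l j) (r j) := ⟨hu.1 j, hu.2 j⟩
    simp only [cornerPoint] at hx hy hz ⊢
    have hxor : ((x j ^^ y j ^^ z j) ^^ (s ^^ t ^^ u)) = (x j ^^ s) ∨
        ((x j ^^ y j ^^ z j) ^^ (s ^^ t ^^ u)) = (y j ^^ t) ∨
        ((x j ^^ y j ^^ z j) ^^ (s ^^ t ^^ u)) = (z j ^^ u) := by
      cases x j <;> cases y j <;> cases z j <;> cases s <;> cases t <;> cases u <;> simp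
    rcases hxor with h | h | h <;> simpa only [h]
  exact ⟨fun j => (key j).1, fun j => (key j).2⟩

theorem compl_mem_cornerSolutions {d : ℕ} {a b : Fin d → ℝ} {B : Set (Fin d → ℝ)}
    {x : Fin d → Bool} (hx : x ∈ cornerSolutions a b B) :
    (fun j => !x j) ∈ cornerSolutions a b B := by
  obtain ⟨s, hs⟩ := hx
  refine ⟨!s, ?_⟩
  convert hs using 3
  simp

theorem pierceable_two_of_mem_cornerSolutions {d : ℕ} {a b : Fin d → ℝ}
    {𝓖 : Set (Set (Fin d → ℝ))} {x : Fin d → Bool} (hx : ∀ B ∈ 𝓖, x ∈ cornerSolutions a b B) :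
    Pierceable 2 𝓖 := by
  classical
  refine ⟨{cornerPoint a b (fun j => x j ^^ false), cornerPoint a b (fun j => x j ^^ true)},
    Finset.card_le_two, fun B hB => ?_⟩
  obtain ⟨s, hs⟩ := hx B hB
  exact ⟨_, by cases s <;> simp, hs⟩

theorem Pierceable.exists_pair {X : Type*} [Nonempty X] {𝓖 : Set (Set X)} (h : Pierceable 2 𝓖) :
    ∃ p q, ∀ B ∈ 𝓖, p ∈ B ∨ q ∈ B := by
  classical
  obtain ⟨P, hP, h⟩ := h
  obtain ⟨p, q, hpq⟩ : ∃ p q, ∀ y ∈ P, y = p ∨ y = q := by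
    rcases P.eq_empty_or_nonempty with rfl | ⟨p, hp⟩
    · exact ⟨Classical.arbitrary X, Classical.arbitrary X, by simp⟩
    · have hcard : (P.erase p).card ≤ 1 := by
        rw [Finset.card_erase_of_mem hp]
        omega
      rcases (P.erase p).eq_empty_or_nonempty with he | ⟨q, hq⟩
      · refine ⟨p, p, fun y hy => ?_⟩
        by_contra! hne
        exact Finset.notMem_empty y (he ▸ Finset.mem_erase.2 ⟨hne.1, hy⟩)
      · refine ⟨p, q, fun y hy => or_iff_not_imp_left.2 fun hne => ?_⟩
        exact Finset.card_le_one.1 hcard y (Finset.mem_erase.2 ⟨hne, hy⟩) q hq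
  refine ⟨p, q, fun B hB => ?_⟩
  obtain ⟨y, hy, hyB⟩ := h B hB
  rcases hpq y hy with rfl | rfl
  · exact Or.inl hyB
  · exact Or.inr hyB

/-- If `p` and `q` pierce boxes ending at `a j` and boxes starting at `b j` for every `j`, then a
single sign vector solves every box containing `p` or `q` that reaches both thresholds in each
coordinate. -/
theorem exists_mem_cornerSolutions {d : ℕ} {a b p q : Fin d → ℝ}
    (ha : ∀ j, p j ≤ a j ∨ q j ≤ a j) (hb : ∀ j, b j ≤ p j ∨ b j ≤ q j) :
    ∃ x : Fin d → Bool, ∀ l r : Fin d → ℝ, (∀ j, a j ≤ r j) → (∀ j, l j ≤ b j) →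
      (p ∈ Set.Icc l r ∨ q ∈ Set.Icc l r) → x ∈ cornerSolutions a b (Set.Icc l r) := by
  classical
  refine ⟨fun j => decide (p j ≤ a j), fun l r har hlb h => ?_⟩
  have key : ∀ j, (p ∈ Set.Icc l r → cornerPoint a b (fun j => decide (p j ≤ a j) ^^ false) j
      ∈ Set.Icc (l j) (r j)) ∧ (q ∈ Set.Icc l r →
      cornerPoint a b (fun j => decide (p j ≤ a j) ^^ true) j ∈ Set.Icc (l j) (r j)) := by
    intro j
    have h₁ := ha j
    have h₂ := hb j
    have h₃ := har j
    have h₄ := hlb j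
    constructor
    all_goals
      rintro ⟨hl, hr⟩
      have hlj := hl j
      have hrj := hr j
      unfold cornerPoint
      by_cases hp : p j ≤ a j <;> by_cases hab : b j ≤ a j <;> simp [hp, hab] <;> grind
  rcases h with h | h
  · exact ⟨false, fun j => ((key j).1 h).1, fun j => ((key j).1 h).2⟩
  · exact ⟨true, fun j => ((key j).2 h).1, fun j => ((key j).2 h).2⟩

/-- Colorful Helly theorem for `2`-piercing of axis-parallel boxes in `ℝ^d`:
if every colorful `3d`-tuple from the nonempty finite families `𝓕 0, …, 𝓕 (3d-1)`
of axis-parallel boxes is `2`-pierceable, then some family `𝓕 i` is `2`-pierceable. -/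
theorem colorful_helly_boxes_two_piercing (d : ℕ) (hd : 1 ≤ d)
    (𝓕 : Fin (3 * d) → Set (Set (Fin d → ℝ)))
    (hfin : ∀ i, (𝓕 i).Finite)
    (hne : ∀ i, (𝓕 i).Nonempty)
    (hbox : ∀ i, ∀ B ∈ 𝓕 i, IsBox B)
    (hcol : ∀ f : Fin (3 * d) → Set (Fin d → ℝ), (∀ i, f i ∈ 𝓕 i) →
      Pierceable 2 {B | ∃ i, B = f i}) :
    ∃ i, Pierceable 2 (𝓕 i) := by
  classical
  have hIcc : ∀ B : Set (Fin d → ℝ), ∃ l r : Fin d → ℝ, IsBox B → B = Set.Icc l r := by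
    intro B
    by_cases h : IsBox B
    · obtain ⟨l, r, _, h⟩ := h
      exact ⟨l, r, fun _ => h⟩
    · exact ⟨0, 0, fun h' => absurd h' h⟩
  choose lo hi hlohi using hIcc
  have hB : ∀ i, ∀ B ∈ 𝓕 i, B = Set.Icc (lo B) (hi B) := fun i B h => hlohi B (hbox i B h)
  let g : Fin d ⊕ Fin d → Set (Fin d → ℝ) → ℝ :=
    Sum.elim (fun j B => hi B j) (fun j B => - lo B j)
  obtain ⟨T, f₁, hT, hf₁, hext⟩ := exists_extremal_transversal 𝓕 hfin hne g Finset.univ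
    (by simp; omega)
  have hTcard : T.card = 2 * d := by simp [hT, two_mul]
  choose u huT hu using fun j => hext (Sum.inl j) (Finset.mem_univ _)
  choose v hvT hv using fun j => hext (Sum.inr j) (Finset.mem_univ _)
  let a : Fin d → ℝ := fun j => hi (f₁ (u j)) j
  let b : Fin d → ℝ := fun j => lo (f₁ (v j)) j
  by_contra! hnot
  obtain ⟨f₂, hf₂, -, hcard⟩ := exists_transversal_few_solutions 𝓕 hne
    (fun B => cornerSolutions a b (Set.Icc (lo B) (hi B)))
    (fun B => isXorClosed_cornerSolutions a b _ _) Tᶜ fun i _ x => by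
      by_contra! h
      exact hnot i (pierceable_two_of_mem_cornerSolutions (a := a) (b := b) (x := x) fun B hBi => by
        rw [hB i B hBi]
        exact h B hBi)
  let f : Fin (3 * d) → Set (Fin d → ℝ) := fun i => if i ∈ T then f₁ i else f₂ i
  have hf : ∀ i, f i ∈ 𝓕 i := fun i => by
    by_cases h : i ∈ T
    · simpa [f, h] using hf₁ i
    · simpa [f, h] using hf₂ i
  obtain ⟨p, q, hpq⟩ := (hcol f hf).exists_pair
  have hpq₁ : ∀ i ∈ T, p ∈ Set.Icc (lo (f₁ i)) (hi (f₁ i)) ∨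
      q ∈ Set.Icc (lo (f₁ i)) (hi (f₁ i)) := fun i hi => by
    rw [← hB i _ (hf₁ i)]
    exact hpq _ ⟨i, by simp [f, hi]⟩
  have hpq₂ : ∀ i ∉ T, p ∈ Set.Icc (lo (f₂ i)) (hi (f₂ i)) ∨
      q ∈ Set.Icc (lo (f₂ i)) (hi (f₂ i)) := fun i hi => by
    rw [← hB i _ (hf₂ i)]
    exact hpq _ ⟨i, by simp [f, hi]⟩
  obtain ⟨x, hx⟩ := exists_mem_cornerSolutions (a := a) (b := b) (p := p) (q := q)
    (fun j => (hpq₁ _ (huT j)).imp (fun h => h.2 j) (fun h => h.2 j))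
    (fun j => (hpq₁ _ (hvT j)).imp (fun h => h.1 j) (fun h => h.1 j))
  have hxmem : ∀ i ∈ Tᶜ, x ∈ cornerSolutions a b (Set.Icc (lo (f₂ i)) (hi (f₂ i))) := by
    intro i hiT
    rw [Finset.mem_compl] at hiT
    exact hx _ _ (fun j => hu j i hiT _ (hf₂ i))
      (fun j => neg_le_neg_iff.1 (hv j i hiT _ (hf₂ i))) (hpq₂ i hiT)
  have hne' : x ≠ fun j => !x j := fun h => by
    have := congrFun h ⟨0, hd⟩
    simp at this
  have htwo : 1 < {x | ∀ i ∈ Tᶜ,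
      x ∈ cornerSolutions a b (Set.Icc (lo (f₂ i)) (hi (f₂ i)))}.ncard :=
    (Set.one_lt_ncard (Set.toFinite _)).2 ⟨x, hxmem, fun j => !x j, fun i hi => compl_mem_cornerSolutions (hxmem i hi), hne'⟩
  have hTc : Tᶜ.card = d := by
    rw [Finset.card_compl, hTcard, Fintype.card_fin]
    omega
  rw [hTc] at hcard
  have : 0 < 2 ^ d := by positivity
  nlinarith
end

section
/- For every d ≥ 1 there exist nonempty finite families 𝓕_1, …, 𝓕_{3d-1} of axis-parallel boxes in ℝ^d such that (i) every colorful (3d-1)-tuple (B_1, …, B_{3d-1}) with B_i ∈ 𝓕_i is 2-pierceable, and (ii) for each i ∈ {1,…,3d-1} the family 𝓕_i is not 2-pierceable. -/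
section

open Set

/-- A set of at most two points has the form `{x, y}` up to inclusion. -/
lemma exists_pair_of_card_le_two {X : Type*} [Nonempty X] {P : Finset X} (hP : P.card ≤ 2) :
    ∃ x y, ∀ z ∈ P, z = x ∨ z = y := by
  classical
  obtain h | h | h : P.card = 0 ∨ P.card = 1 ∨ P.card = 2 := by omega
  · obtain ⟨x⟩ := ‹Nonempty X›
    exact ⟨x, x, by simp [Finset.card_eq_zero.mp h]⟩
  · obtain ⟨x, rfl⟩ := Finset.card_eq_one.mp h
    exact ⟨x, x, by simp⟩
  · obtain ⟨x, y, -, rfl⟩ := Finset.card_eq_two.mp h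
    exact ⟨x, y, by simp⟩

/-- If two points pierce a sequence of sets in which consecutive sets are disjoint, then they
alternate along it. -/
lemma mem_of_even_of_disjoint_succ {X : Type*} {B : ℕ → Set X} {p n : ℕ} {x y : X}
    (hB : ∀ t < 2 * n, Disjoint (B (p + t)) (B (p + t + 1)))
    (hxy : ∀ t ≤ 2 * n, x ∈ B (p + t) ∨ y ∈ B (p + t)) (hx : x ∈ B p) :
    x ∈ B (p + 2 * n) := by
  have key : ∀ k ≤ n, x ∈ B (p + 2 * k) := by
    intro k
    induction k with
    | zero => simpa using hx
    | succ k ih =>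
      intro hk
      have h₁ := disjoint_left.mp (hB (2 * k) (by omega)) (ih (by omega))
      have h₂ := (hxy (2 * k + 1) (by omega)).resolve_left h₁
      exact (hxy (2 * k + 2) (by omega)).resolve_right
        (disjoint_left.mp (hB (2 * k + 1) (by omega)) h₂)
  exact key n le_rfl

/-- A family containing an odd cycle of the disjointness graph is not `2`-pierceable. -/
lemma not_pierceable_two_of_odd_cycle {X : Type*} {𝓕 : Set (Set X)} {B : ℕ → Set X} {p n : ℕ}
    (hmem : ∀ t ≤ 2 * n, B (p + t) ∈ 𝓕)
    (hB : ∀ t < 2 * n, Disjoint (B (p + t)) (B (p + t + 1)))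
    (hlast : Disjoint (B (p + 2 * n)) (B p)) : ¬ Pierceable 2 𝓕 := by
  rintro ⟨P, hP, h⟩
  obtain ⟨z, -, -⟩ := h _ (hmem 0 (by omega))
  have : Nonempty X := ⟨z⟩
  obtain ⟨x, y, hP⟩ := exists_pair_of_card_le_two hP
  have hxy : ∀ t ≤ 2 * n, x ∈ B (p + t) ∨ y ∈ B (p + t) := by
    intro t ht
    obtain ⟨z, hz, hzB⟩ := h _ (hmem t ht)
    obtain rfl | rfl := hP z hz
    exacts [.inl hzB, .inr hzB]
  obtain hx | hy := hxy 0 (by omega)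
  · exact disjoint_left.mp hlast (mem_of_even_of_disjoint_succ hB hxy hx) hx
  · exact disjoint_left.mp hlast
      (mem_of_even_of_disjoint_succ hB (fun t ht => (hxy t ht).symm) hy) hy

/-- Boxes that can be `2`-coloured so that boxes of the same colour pairwise intersect are
`2`-pierceable. -/
lemma pierceable_two_of_coloring {ι κ : Type*} [Finite ι] (a b : ι → κ → ℝ) (c : ι → Bool)
    (h : ∀ i j, c i = c j → a i ≤ b j) : Pierceable 2 {B | ∃ i, B = Icc (a i) (b i)} := by
  classical
  let x : Bool → κ → ℝ := fun s k => ⨆ i : {i // c i = s}, a i k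
  refine ⟨{x true, x false}, Finset.card_le_two, ?_⟩
  rintro _ ⟨i, rfl⟩
  refine ⟨x (c i), by cases c i <;> simp, fun k => ?_, fun k => ?_⟩
  · exact le_ciSup (f := fun j : {j // c j = c i} => a j k) (Set.finite_range _).bddAbove ⟨i, rfl⟩
  · have : Nonempty {j // c j = c i} := ⟨⟨i, rfl⟩⟩
    exact ciSup_le fun j => h j i j.2 k

/-- Lower endpoint, in coordinate `k`, of the box with label `v`. The labels `s, …, 3 * d - 1`
form an odd cycle of the disjointness graph, the edges `{v, v + 1}` with `v / 3 = k` being realized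
in coordinate `k`. The labels `3 * d, 3 * d + 1, 3 * d + 2` form a triangle. -/
def boxLower (d s k v : ℕ) : ℕ :=
  if v < 3 * d then
    if v = 3 * k + 1 then 3 else if v = 3 * k + 3 ∨ (k + 1 = d ∧ v = s) then 1 else 0
  else if v = 3 * d + 1 ∧ k = 1 then 2
  else if v = 3 * d + 2 ∧ k = 0 then 4 else 0

/-- Upper endpoint, in coordinate `k`, of the box with label `v`; see `boxLower`. -/
def boxUpper (d k v : ℕ) : ℕ :=
  if v < 3 * d then if v = 3 * k then 2 else if v = 3 * k + 2 then 0 else 4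
  else if v < 3 * d + 2 ∧ k = 0 then 3
  else if v = 3 * d ∧ k = 1 then 1 else 4

/-- The box in `ℝ^d` with label `v`. -/
def labelledBox (d s v : ℕ) : Set (Fin d → ℝ) :=
  Icc (fun k => (boxLower d s k v : ℝ)) (fun k => (boxUpper d k v : ℝ))

lemma boxLower_le_boxUpper {d s k v : ℕ} (hs : s ≤ 1) :
    boxLower d s k v ≤ boxUpper d k v := by
  unfold boxLower boxUpper
  split_ifs <;> omega

lemma disjoint_labelledBox {d s u v : ℕ} (k : ℕ) (hk : k < d)
    (h : boxUpper d k u < boxLower d s k v ∨ boxUpper d k v < boxLower d s k u) :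
    Disjoint (labelledBox d s u) (labelledBox d s v) := by
  rw [disjoint_left]
  rintro x ⟨hu, hu'⟩ ⟨hv, hv'⟩
  have h₁ := (hv ⟨k, hk⟩).trans (hu' ⟨k, hk⟩)
  have h₂ := (hu ⟨k, hk⟩).trans (hv' ⟨k, hk⟩)
  simp only [Nat.cast_le] at h₁ h₂
  omega

lemma not_pierceable_cycle {d s : ℕ} (hd : 1 ≤ d) (hs : s = (d + 1) % 2) :
    ¬ Pierceable 2 (labelledBox d s '' Ico s (3 * d)) := by
  obtain ⟨n, hn⟩ : ∃ n, 3 * d - 1 - s = 2 * n := ⟨(3 * d - 1 - s) / 2, by omega⟩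
  refine not_pierceable_two_of_odd_cycle (B := labelledBox d s) (p := s) (n := n)
    (fun t ht => ⟨s + t, ⟨by omega, by omega⟩, rfl⟩) (fun t ht => ?_) ?_
  · refine disjoint_labelledBox ((s + t) / 3) (by omega) ?_
    obtain h | h : (s + t) % 3 = 1 ∨ (s + t) % 3 ≠ 1 := by omega
    · right
      unfold boxLower boxUpper
      split_ifs <;> omega
    · left
      unfold boxLower boxUpper
      split_ifs <;> omega
  · refine disjoint_labelledBox (d - 1) (by omega) (.inl ?_)
    unfold boxLower boxUpper
    split_ifs <;> omega

lemma not_pierceable_triangle {d s : ℕ} (hd : 2 ≤ d) :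
    ¬ Pierceable 2 (labelledBox d s '' Ico (3 * d) (3 * d + 3)) := by
  refine not_pierceable_two_of_odd_cycle (B := labelledBox d s) (p := 3 * d) (n := 1)
    (fun t ht => ⟨3 * d + t, ⟨by omega, by omega⟩, rfl⟩) (fun t ht => ?_) ?_
  · refine disjoint_labelledBox (1 - t) (by omega) (.inl ?_)
    unfold boxLower boxUpper
    split_ifs <;> omega
  · refine disjoint_labelledBox 0 (by omega) (.inr ?_)
    unfold boxLower boxUpper
    split_ifs <;> omega

/-- Two boxes of the cycle, both different from the box `m`, intersect unless they get different
colours in the alternating colouring of the path obtained by deleting `m`. -/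
lemma boxLower_le_boxUpper_of_cycle {d s k m v w : ℕ} (hs : s = (d + 1) % 2)
    (hv : v ∈ Ico s (3 * d)) (hw : w ∈ Ico s (3 * d))
    (hm : m ∈ Ico s (3 * d)) (hvm : v ≠ m) (hwm : w ≠ m)
    (h : (v + if m < v then 1 else 0) % 2 = (w + if m < w then 1 else 0) % 2) :
    boxLower d s k v ≤ boxUpper d k w := by
  simp only [mem_Ico] at hv hw hm
  unfold boxLower boxUpper
  rw [if_pos hv.2, if_pos hw.2]
  split_ifs at h ⊢ <;> omega

/-- The box of the cycle that is disjoint from the box `e` of the triangle. -/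
def triangleNeighbor (d e : ℕ) : ℕ := if e = 3 * d then 4 else if e = 3 * d + 1 then 5 else 2

lemma boxLower_le_boxUpper_of_ne_triangleNeighbor {d s k v e : ℕ} (hs : s = 1)
    (hv : v ∈ Ico s (3 * d)) (he : e ∈ Ico (3 * d) (3 * d + 3)) (h : v ≠ triangleNeighbor d e) :
    boxLower d s k v ≤ boxUpper d k e ∧ boxLower d s k e ≤ boxUpper d k v := by
  simp only [mem_Ico] at hv he
  have h' : e = 3 * d ∧ v ≠ 4 ∨ e = 3 * d + 1 ∧ v ≠ 5 ∨ e = 3 * d + 2 ∧ v ≠ 2 := by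
    unfold triangleNeighbor at h
    split_ifs at h <;> omega
  clear h
  unfold boxLower boxUpper
  rw [if_pos hv.2, if_pos hv.2, if_neg he.1.not_gt, if_neg he.1.not_gt]
  constructor <;> split_ifs <;> omega

/-- The labels of the boxes in the `i`-th family: the cycle, except that for even `d` the last
family is the triangle. -/
def familyLabels (d s i : ℕ) : Set ℕ :=
  if i + s < 3 * d - 1 then Ico s (3 * d) else Ico (3 * d) (3 * d + 3)

/-- A choice of boxes from the families misses some box of the cycle. -/
lemma exists_label_notMem_range {d s : ℕ} (hd : 1 ≤ d) (hs : s ≤ 1) (v : Fin (3 * d - 1) → ℕ)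
    (hv : ∀ i : Fin (3 * d - 1), v i ∈ familyLabels d s i) : ∃ m ∈ Ico s (3 * d), ∀ i, v i ≠ m := by
  classical
  by_contra! H
  let I : Finset (Fin (3 * d - 1)) := Finset.univ.filter fun i => (i : ℕ) + s < 3 * d - 1
  have hsub : Finset.Ico s (3 * d) ⊆ I.image v := by
    intro m hm
    obtain ⟨i, rfl⟩ := H m (by simpa using hm)
    refine Finset.mem_image_of_mem v (Finset.mem_filter.mpr ⟨Finset.mem_univ _, ?_⟩)
    by_contra hi
    have := hv i
    rw [familyLabels, if_neg hi] at this
    have := this.1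
    simp only [Finset.mem_Ico] at hm
    omega
  have hI : I.card ≤ 3 * d - 1 - s := by
    calc I.card = (I.image Fin.val).card := (Finset.card_image_of_injective _ Fin.val_injective).symm
      _ ≤ (Finset.range (3 * d - 1 - s)).card := by
        refine Finset.card_le_card fun j hj => ?_
        obtain ⟨i, hi, rfl⟩ := Finset.mem_image.mp hj
        have := (Finset.mem_filter.mp hi).2
        simp only [Finset.mem_range]
        omega
      _ = _ := Finset.card_range _
  have := (Finset.card_le_card hsub).trans (Finset.card_image_le.trans hI)
  simp only [Nat.card_Ico] at this
  omega

lemma pierceable_colorful {d s : ℕ} (hd : 1 ≤ d) (hs : s = (d + 1) % 2)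
    (v : Fin (3 * d - 1) → ℕ) (hv : ∀ i : Fin (3 * d - 1), v i ∈ familyLabels d s i) :
    Pierceable 2 {B | ∃ i, B = labelledBox d s (v i)} := by
  obtain ⟨m, hm, hvm⟩ := exists_label_notMem_range hd (by omega) v hv
  let c : ℕ → ℕ := fun w => (w + if m < w then 1 else 0) % 2
  let c' : ℕ → ℕ := fun w => if w < 3 * d then c w else 1 - c (triangleNeighbor d w)
  have hc : ∀ w, c w < 2 := fun w => Nat.mod_lt _ two_pos
  have hc' : ∀ w, c' w < 2 := fun w => by
    have := hc w
    dsimp only [c']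
    split_ifs <;> omega
  refine pierceable_two_of_coloring _ _ (fun i => decide (c' (v i) = 0)) fun i j hij k => ?_
  have hij : c' (v i) = c' (v j) := by
    have := hc' (v i)
    have := hc' (v j)
    simp only [decide_eq_decide] at hij
    omega
  simp only [Nat.cast_le]
  have hi := hv i
  have hj := hv j
  have hne : ∀ {u e : ℕ}, u < 3 * d → ¬ e < 3 * d → c' u = c' e → u ≠ triangleNeighbor d e := by
    rintro u e hu he h rfl
    have := hc (triangleNeighbor d e)
    simp only [c', if_pos hu, if_neg he] at h
    omega
  unfold familyLabels at hi hj
  split_ifs at hi hj with h₁ h₂ h₂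
  · simp only [c', if_pos hi.2, if_pos hj.2] at hij
    exact boxLower_le_boxUpper_of_cycle hs hi hj hm (hvm i) (hvm j) hij
  · exact (boxLower_le_boxUpper_of_ne_triangleNeighbor (by omega) hi hj
      (hne hi.2 (not_lt.mpr hj.1) hij)).1
  · exact (boxLower_le_boxUpper_of_ne_triangleNeighbor (by omega) hj hi
      (hne hj.2 (not_lt.mpr hi.1) hij.symm)).2
  · obtain rfl : i = j := Fin.ext (by omega)
    exact boxLower_le_boxUpper (by omega)

end

/-- Lower bound for the colorful Helly number for `2`-piercing of axis-parallel boxes: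
for every `d ≥ 1` there are nonempty finite families `𝓕 0, …, 𝓕 (3d-2)` of
axis-parallel boxes in `ℝ^d` such that every colorful `(3d-1)`-tuple is `2`-pierceable,
yet no family `𝓕 i` is `2`-pierceable. -/
theorem colorful_helly_boxes_two_piercing_lower_bound (d : ℕ) (hd : 1 ≤ d) :
    ∃ 𝓕 : Fin (3 * d - 1) → Set (Set (Fin d → ℝ)),
      (∀ i, (𝓕 i).Finite) ∧
      (∀ i, (𝓕 i).Nonempty) ∧
      (∀ i, ∀ B ∈ 𝓕 i, IsBox B) ∧
      (∀ f : Fin (3 * d - 1) → Set (Fin d → ℝ), (∀ i, f i ∈ 𝓕 i) →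
        Pierceable 2 {B | ∃ i, B = f i}) ∧
      (∀ i, ¬ Pierceable 2 (𝓕 i)) := by
  obtain ⟨s, hs⟩ : ∃ s, s = (d + 1) % 2 := ⟨_, rfl⟩
  refine ⟨fun i => labelledBox d s '' familyLabels d s i, fun i => ?_, fun i => ?_, ?_, ?_,
    fun i => ?_⟩
  · refine Set.Finite.image _ ?_
    unfold familyLabels
    split_ifs
    exacts [Set.finite_Ico _ _, Set.finite_Ico _ _]
  · refine Set.Nonempty.image _ ?_
    unfold familyLabels
    split_ifs
    exacts [Set.nonempty_Ico.mpr (by omega), Set.nonempty_Ico.mpr (by omega)]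
  · rintro i _ ⟨v, -, rfl⟩
    exact ⟨_, _, fun k => Nat.cast_le.mpr (boxLower_le_boxUpper (by omega)), rfl⟩
  · intro f hf
    choose v hv hvf using hf
    simpa only [hvf] using pierceable_colorful hd hs v hv
  · dsimp only
    unfold familyLabels
    split_ifs with h
    · exact not_pierceable_cycle hd hs
    · exact not_pierceable_triangle (by omega)
end

section
/- Let d ≥ 1, n ≥ d+1, and let 𝓕_1, …, 𝓕_n be nonempty finite families of axis-parallel boxes in ℝ^d such that every colorful pair of boxes intersects, i.e. for all i ≠ j, every B ∈ 𝓕_i and B' ∈ 𝓕_j satisfy B ∩ B' ≠ ∅. Then there exists i ∈ {1,…,n} such that the intersection of all boxes in 𝓕_i is nonempty. -/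
/-- Finitely many boxes whose coordinate projections pairwise intersect have a common point. -/
theorem IsBox.nonempty_biInter_of_pairwise {d : ℕ} {S : Set (Set (Fin d → ℝ))}
    (hfin : S.Finite) (hne : S.Nonempty) (hbox : ∀ B ∈ S, IsBox B)
    (h : ∀ a b a' b' : Fin d → ℝ, Set.Icc a b ∈ S → Set.Icc a' b' ∈ S → ∀ j, a' j ≤ b j) :
    (⋂ B ∈ S, B).Nonempty := by
  have hbox' : ∀ B : Set (Fin d → ℝ), ∃ a b : Fin d → ℝ, B ∈ S → B = Set.Icc a b := by
    intro B
    by_cases hB : B ∈ S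
    · obtain ⟨a, b, -, hab⟩ := hbox B hB
      exact ⟨a, b, fun _ => hab⟩
    · exact ⟨0, 0, fun hB' => absurd hB' hB⟩
  choose a b hab using hbox'
  have hmax : ∀ j, ∃ C ∈ S, ∀ B ∈ S, a B j ≤ a C j := fun j =>
    Set.exists_max_image S (fun B => a B j) hfin hne
  choose C hCS hC using hmax
  refine ⟨fun j => a (C j) j, Set.mem_iInter₂.2 fun B hB => ?_⟩
  rw [hab B hB]
  refine ⟨fun j => hC j B hB, fun j => h (a B) (b B) (a (C j)) (b (C j)) ?_ ?_ j⟩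
  · rwa [← hab B hB]
  · rw [← hab (C j) (hCS j)]
    exact hCS j

/-- Two intersecting boxes have intersecting coordinate projections. -/
theorem Set.Icc_inter_nonempty_le {d : ℕ} {a b a' b' : Fin d → ℝ}
    (h : (Set.Icc a b ∩ Set.Icc a' b').Nonempty) (j : Fin d) : a j ≤ b' j ∧ a' j ≤ b j := by
  obtain ⟨x, hx, hx'⟩ := h
  exact ⟨(hx.1 j).trans (hx'.2 j), (hx'.1 j).trans (hx.2 j)⟩

/-- Colorful Helly theorem for axis-parallel boxes: if `n ≥ d + 1` and every colorful
pair of boxes from the nonempty finite families `𝓕 0, …, 𝓕 (n-1)` of axis-parallel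
boxes in `ℝ^d` intersects, then all boxes of some family `𝓕 i` have a common point. -/
theorem colorful_helly_boxes_pairwise (d n : ℕ) (hd : 1 ≤ d) (hn : d + 1 ≤ n)
    (𝓕 : Fin n → Set (Set (Fin d → ℝ)))
    (hfin : ∀ i, (𝓕 i).Finite)
    (hne : ∀ i, (𝓕 i).Nonempty)
    (hbox : ∀ i, ∀ B ∈ 𝓕 i, IsBox B)
    (hpair : ∀ i j, i ≠ j → ∀ B ∈ 𝓕 i, ∀ B' ∈ 𝓕 j, (B ∩ B').Nonempty) :
    ∃ i : Fin n, (⋂ B ∈ 𝓕 i, B).Nonempty := by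
  by_contra hcon
  have hsep : ∀ i, ∃ a b a' b' : Fin d → ℝ, Set.Icc a b ∈ 𝓕 i ∧ Set.Icc a' b' ∈ 𝓕 i ∧
      ∃ j, b j < a' j := by
    intro i
    by_contra hi
    refine hcon ⟨i, IsBox.nonempty_biInter_of_pairwise (hfin i) (hne i) (hbox i) ?_⟩
    intro a b a' b' hB hB' j
    by_contra hj
    exact hi ⟨a, b, a', b', hB, hB', j, not_le.1 hj⟩
  choose a b a' b' hB hB' f hf using hsep
  obtain ⟨i, k, hik, hfik⟩ := Fintype.exists_ne_map_eq_of_card_lt f (by simpa using hn)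
  have h₁ := (Set.Icc_inter_nonempty_le (hpair i k hik _ (hB i) _ (hB' k)) (f i)).2
  have h₂ := (Set.Icc_inter_nonempty_le (hpair i k hik _ (hB' i) _ (hB k)) (f i)).1
  have h₃ := hf i
  have h₄ := hf k
  rw [← hfik] at h₄
  linarith
end

section
/- Let d ≥ 1, n > d+1, and let 𝓕_1, …, 𝓕_n be nonempty finite families of axis-parallel boxes in ℝ^d such that every colorful pair of boxes intersects, i.e. for all i ≠ j, every B ∈ 𝓕_i and B' ∈ 𝓕_j satisfy B ∩ B' ≠ ∅. Then there exists i ∈ {1,…,n} and, for each j ∈ {1,…,n} with j ≠ i, a box B_j ∈ 𝓕_j, such that the family 𝓕_i ∪ {B_j : j ∈ {1,…,n}, j ≠ i} is 2-pierceable. -/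
/-- A nonempty family of order intervals in `ι → ℝ`, each of whose left endpoints lies below
each right endpoint, has a common point. -/
theorem exists_mem_forall_Icc_of_pairwise_le {ι : Type*} {𝓖 : Set (Set (ι → ℝ))}
    (hne : 𝓖.Nonempty) (a b : Set (ι → ℝ) → ι → ℝ) (hIcc : ∀ B ∈ 𝓖, B = Set.Icc (a B) (b B))
    (hab : ∀ B ∈ 𝓖, ∀ C ∈ 𝓖, a B ≤ b C) : ∃ p, ∀ B ∈ 𝓖, p ∈ B := by
  refine ⟨fun k => sSup ((fun B => a B k) '' 𝓖), fun B hB => ?_⟩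
  rw [hIcc B hB]
  refine ⟨fun k => le_csSup ⟨b B k, ?_⟩ ⟨B, hB, rfl⟩, fun k => csSup_le (hne.image _) ?_⟩
  all_goals
    rintro _ ⟨C, hC, rfl⟩
    exact hab C hC B hB k

/-- Among more than `d` families of intervals in `ℝ^d` with left endpoints `a` and right
endpoints `b`, if left endpoints lie below right endpoints across distinct families, then this
also holds within one of the families. -/
theorem exists_forall_le_of_colorful_le {α : Type*} {d n : ℕ} (hn : d < n) (𝓕 : Fin n → Set α)
    (a b : α → Fin d → ℝ)
    (hab : ∀ i j, i ≠ j → ∀ B ∈ 𝓕 i, ∀ C ∈ 𝓕 j, a B ≤ b C) :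
    ∃ i, ∀ B ∈ 𝓕 i, ∀ C ∈ 𝓕 i, a B ≤ b C := by
  by_contra! h
  simp only [Pi.le_def, not_forall, not_le] at h
  choose B hB C hC k hk using h
  obtain ⟨i, j, hij, hkij⟩ := Fintype.exists_ne_map_eq_of_card_lt k (by simpa using hn)
  have hi := hk i
  have hj := hk j
  rw [← hkij] at hj
  have hBC := hab i j hij (B i) (hB i) (C j) (hC j) (k i)
  have hCB := hab j i hij.symm (B j) (hB j) (C i) (hC i) (k i)
  linarith

/-- If `n > d + 1` and every colorful pair of boxes from the nonempty finite families
`𝓕 0, …, 𝓕 (n-1)` of axis-parallel boxes in `ℝ^d` intersects, then there is an `i`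
and a choice of a box `B j ∈ 𝓕 j` for each `j ≠ i` such that `𝓕 i` together with these
chosen boxes is `2`-pierceable. -/
theorem colorful_pairwise_intersecting_two_pierceable (d n : ℕ) (hd : 1 ≤ d)
    (hn : d + 1 < n)
    (𝓕 : Fin n → Set (Set (Fin d → ℝ)))
    (hfin : ∀ i, (𝓕 i).Finite)
    (hne : ∀ i, (𝓕 i).Nonempty)
    (hbox : ∀ i, ∀ B ∈ 𝓕 i, IsBox B)
    (hpair : ∀ i j, i ≠ j → ∀ B ∈ 𝓕 i, ∀ B' ∈ 𝓕 j, (B ∩ B').Nonempty) :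
    ∃ i : Fin n, ∃ B : Fin n → Set (Fin d → ℝ),
      (∀ j, j ≠ i → B j ∈ 𝓕 j) ∧
      Pierceable 2 (𝓕 i ∪ {C | ∃ j, j ≠ i ∧ C = B j}) := by
  choose! a b hle hIcc using fun (B : Set (Fin d → ℝ)) (hB : IsBox B) => hB
  have hab : ∀ i j, i ≠ j → ∀ B ∈ 𝓕 i, ∀ C ∈ 𝓕 j, a B ≤ b C := by
    intro i j hij B hB C hC
    obtain ⟨x, hxB, hxC⟩ := hpair i j hij B hB C hC
    rw [hIcc B (hbox i B hB)] at hxB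
    rw [hIcc C (hbox j C hC)] at hxC
    exact hxB.1.trans hxC.2
  obtain ⟨i, hi⟩ := exists_forall_le_of_colorful_le (by omega) 𝓕 a b hab
  choose B hB using hne
  refine ⟨i, B, fun j _ => hB j, ?_⟩
  obtain ⟨p, hp⟩ : ∃ p, ∀ C ∈ 𝓕 i ∪ {C | ∃ j, j ≠ i ∧ C = B j}, p ∈ C := by
    refine exists_mem_forall_Icc_of_pairwise_le ⟨B i, Or.inl (hB i)⟩ a b ?_ ?_
    · rintro C (hC | ⟨j, -, rfl⟩)
      · exact hIcc C (hbox i C hC)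
      · exact hIcc _ (hbox j _ (hB j))
    · rintro C (hC | ⟨j, hj, rfl⟩) D (hD | ⟨l, hl, rfl⟩)
      · exact hi C hC D hD
      · exact hab i l hl.symm C hC _ (hB l)
      · exact hab j i hj _ (hB j) D hD
      · by_cases hjl : j = l
        · subst hjl
          exact hle _ (hbox j _ (hB j))
        · exact hab j l hjl _ (hB j) _ (hB l)
  exact ⟨{p}, by simp, fun C hC => ⟨p, by simp, hp C hC⟩⟩
end

section
/- Let d ≥ 1, n ≥ 2, and let 𝓕_1, …, 𝓕_n be nonempty finite families of axis-parallel boxes in ℝ^d. Suppose there exists j ∈ {1,…,d} such that for all ℓ ≠ k and all B ∈ 𝓕_ℓ, B' ∈ 𝓕_k we have Π_j(B) ∩ Π_j(B') ≠ ∅. Then there exists a subset S ⊆ {1,…,n} with |S| ≥ n-1 such that for every i ∈ S there is a constant c ∈ ℝ with the hyperplane {x ∈ ℝ^d : x_j = c} intersecting every member of 𝓕_i (equivalently, c ∈ Π_j(B) for every B ∈ 𝓕_i). -/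
/-- A nonempty finite family of boxes, no two of which are strictly separated in the `j`-th
coordinate, is hit by a hyperplane orthogonal to the `j`-th coordinate axis. -/
theorem exists_hyperplane_of_not_separated {d : ℕ} {F : Set (Set (Fin d → ℝ))}
    (hfin : F.Finite) (hne : F.Nonempty) (hbox : ∀ B ∈ F, IsBox B) (j : Fin d)
    (h : ∀ B ∈ F, ∀ B' ∈ F, ∃ x ∈ B, ∃ y ∈ B', y j ≤ x j) :
    ∃ c : ℝ, ∀ B ∈ F, ∃ x ∈ B, x j = c := by
  classical
  obtain ⟨B₀, hB₀, hmax⟩ := Set.exists_max_image F (fun B => sInf ((· j) '' B)) hfin hne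
  have lower : ∀ a b : Fin d → ℝ, a ≤ b → sInf ((· j) '' Set.Icc a b) = a j := by
    intro a b hab
    refine IsLeast.csInf_eq ⟨⟨a, ⟨le_rfl, hab⟩, rfl⟩, ?_⟩
    rintro _ ⟨x, hx, rfl⟩
    exact hx.1 j
  obtain ⟨a₀, b₀, hab₀, rfl⟩ := hbox B₀ hB₀
  refine ⟨a₀ j, fun B hB => ?_⟩
  obtain ⟨x, hx, y, hy, hyx⟩ := h B hB _ hB₀
  have hle := hmax B hB
  obtain ⟨a, b, hab, rfl⟩ := hbox B hB
  simp only [lower a b hab, lower a₀ b₀ hab₀] at hle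
  refine ⟨Function.update a j (a₀ j), ⟨?_, ?_⟩, by simp⟩
  · exact le_update_iff.2 ⟨hle, fun _ _ => le_rfl⟩
  · exact update_le_iff.2 ⟨(hy.1 j).trans (hyx.trans (hx.2 j)), fun i _ => hab i⟩

/-- If for some coordinate `j` the `j`-th projections of any two boxes from different
families among `𝓕 0, …, 𝓕 (n-1)` intersect, then all but at most one of the families
can each be hit by a hyperplane orthogonal to the `j`-th coordinate axis. -/
theorem all_but_one_family_hit_by_hyperplane (d n : ℕ) (hd : 1 ≤ d) (hn : 2 ≤ n)
    (𝓕 : Fin n → Set (Set (Fin d → ℝ)))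
    (hfin : ∀ i, (𝓕 i).Finite)
    (hne : ∀ i, (𝓕 i).Nonempty)
    (hbox : ∀ i, ∀ B ∈ 𝓕 i, IsBox B)
    (j : Fin d)
    (hproj : ∀ ℓ k, ℓ ≠ k → ∀ B ∈ 𝓕 ℓ, ∀ B' ∈ 𝓕 k,
      ∃ x ∈ B, ∃ y ∈ B', x j = y j) :
    ∃ S : Finset (Fin n), n - 1 ≤ S.card ∧
      ∀ i ∈ S, ∃ c : ℝ, ∀ B ∈ 𝓕 i, ∃ x ∈ B, x j = c := by
  classical
  refine ⟨Finset.univ.filter fun i => ∃ c : ℝ, ∀ B ∈ 𝓕 i, ∃ x ∈ B, x j = c, ?_,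
    fun i hi => (Finset.mem_filter.1 hi).2⟩
  have separated : ∀ i, (¬ ∃ c : ℝ, ∀ B ∈ 𝓕 i, ∃ x ∈ B, x j = c) →
      ∃ B ∈ 𝓕 i, ∃ B' ∈ 𝓕 i, ∀ x ∈ B, ∀ y ∈ B', x j < y j := by
    intro i hi
    by_contra! hsep
    exact hi (exists_hyperplane_of_not_separated (hfin i) (hne i) (hbox i) j hsep)
  have hcard : (Finset.univ.filter fun i =>
      ¬ ∃ c : ℝ, ∀ B ∈ 𝓕 i, ∃ x ∈ B, x j = c).card ≤ 1 := by
    refine Finset.card_le_one.2 fun ℓ hℓ k hk => ?_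
    by_contra hne'
    obtain ⟨B₁, h₁, B₂, h₂, hB⟩ := separated ℓ (Finset.mem_filter.1 hℓ).2
    obtain ⟨C₁, k₁, C₂, k₂, hC⟩ := separated k (Finset.mem_filter.1 hk).2
    obtain ⟨x, hx, y, hy, hxy⟩ := hproj ℓ k hne' B₁ h₁ C₂ k₂
    obtain ⟨z, hz, w, hw, hzw⟩ := hproj ℓ k hne' B₂ h₂ C₁ k₁
    linarith [hB x hx z hz, hC w hw y hy]
  have htotal := Finset.card_filter_add_card_filter_not (s := (Finset.univ : Finset (Fin n)))
    fun i => ∃ c : ℝ, ∀ B ∈ 𝓕 i, ∃ x ∈ B, x j = c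
  rw [Finset.card_univ, Fintype.card_fin] at htotal
  omega
end

section
/- Let B = ∏_{j=1}^d [α_j, β_j] be an axis-parallel box in ℝ^d with α_j < β_j for all j, let (λ, λ') be a diagonally opposite pair of vertices of B, and let B' be an axis-parallel box in ℝ^d with B' ∩ {λ, λ'} = ∅. Then B' is disjoint from at least two faces of B; that is, there exist two distinct faces F_1 and F_2 of B with B' ∩ F_1 = ∅ and B' ∩ F_2 = ∅. -/
/-- `F` is a face of the axis-parallel box `∏_j [α j, β j]`. -/
def IsFaceOf {d : ℕ} (α β : Fin d → ℝ) (F : Set (Fin d → ℝ)) : Prop :=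
  ∃ j : Fin d, F = {x ∈ Set.Icc α β | x j = α j} ∨ F = {x ∈ Set.Icc α β | x j = β j}

/-- The section of a set by the hyperplane `x j = c` is disjoint from any box whose `j`-th
side does not contain `c`. -/
theorem Icc_inter_hyperplane_section_eq_empty {ι : Type*} {a b : ι → ℝ} {j : ι} {c : ℝ}
    (hc : c ∉ Set.Icc (a j) (b j)) (S : Set (ι → ℝ)) :
    Set.Icc a b ∩ {x ∈ S | x j = c} = ∅ := by
  ext x
  simp only [Set.mem_inter_iff, Set.mem_ofPred_eq, Set.mem_empty_iff_false, iff_false]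
  rintro ⟨hx, -, rfl⟩
  exact hc ⟨hx.1 j, hx.2 j⟩

/-- A point outside a box has a coordinate outside the corresponding side. -/
theorem exists_apply_notMem_Icc {ι : Type*} {a b x : ι → ℝ} (hx : x ∉ Set.Icc a b) :
    ∃ j, x j ∉ Set.Icc (a j) (b j) := by
  by_contra! h
  exact hx ⟨fun j => (h j).1, fun j => (h j).2⟩

/-- If `B'` is an axis-parallel box disjoint from a diagonally opposite pair of vertices
`(lam, lam')` of the (nondegenerate) box `∏_j [α j, β j]`, then `B'` is disjoint from at
least two distinct faces of that box. -/
theorem box_missing_diagonal_pair_misses_two_faces (d : ℕ)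
    (α β : Fin d → ℝ) (hαβ : ∀ j, α j < β j)
    (lam lam' : Fin d → ℝ)
    (hdiag : ∀ j, ({lam j, lam' j} : Set ℝ) = {α j, β j})
    (B' : Set (Fin d → ℝ)) (hB' : IsBox B')
    (hmiss : B' ∩ {lam, lam'} = ∅) :
    ∃ F₁ F₂ : Set (Fin d → ℝ), F₁ ≠ F₂ ∧
      IsFaceOf α β F₁ ∧ IsFaceOf α β F₂ ∧
      B' ∩ F₁ = ∅ ∧ B' ∩ F₂ = ∅ := by
  obtain ⟨a, b, -, rfl⟩ := hB'
  have hcoord : ∀ j, (lam j = α j ∧ lam' j = β j) ∨ (lam j = β j ∧ lam' j = α j) :=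
    fun j => Set.pair_eq_pair_iff.mp (hdiag j)
  have hlam : lam ∉ Set.Icc a b := fun h =>
    (Set.eq_empty_iff_forall_notMem.mp hmiss lam) ⟨h, by simp⟩
  have hlam' : lam' ∉ Set.Icc a b := fun h =>
    (Set.eq_empty_iff_forall_notMem.mp hmiss lam') ⟨h, by simp⟩
  have hmem : lam ∈ Set.Icc α β := by
    constructor <;> intro j <;> rcases hcoord j with h | h <;> linarith [hαβ j, h.1]
  obtain ⟨j, hj⟩ := exists_apply_notMem_Icc hlam
  obtain ⟨k, hk⟩ := exists_apply_notMem_Icc hlam'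
  refine ⟨{x ∈ Set.Icc α β | x j = lam j}, {x ∈ Set.Icc α β | x k = lam' k}, ?_, ⟨j, ?_⟩, ⟨k, ?_⟩,
    Icc_inter_hyperplane_section_eq_empty hj _, Icc_inter_hyperplane_section_eq_empty hk _⟩
  · intro h
    have hlamk : lam ∈ {x ∈ Set.Icc α β | x k = lam' k} := h ▸ ⟨hmem, rfl⟩
    have hlt := hαβ k
    rcases hcoord k with h' | h' <;> linarith [hlamk.2, h'.1, h'.2]
  · rcases hcoord j with h | h <;> simp [h.1]
  · rcases hcoord k with h | h <;> simp [h.2]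
end

section
/- Let V = ∏_{j=1}^d [α_j, β_j] be an axis-parallel box in ℝ^d and let 𝓖_1, …, 𝓖_n be nonempty families of axis-parallel boxes in ℝ^d satisfying: (i) for every i ∈ {1,…,n}, every B ∈ 𝓖_i, and every j ∈ {1,…,d}, Π_j(B) ∩ {α_j, β_j} ≠ ∅ (so B contains at least one vertex of V); and (ii) every colorful n-tuple from 𝓖_1, …, 𝓖_n is pierced by at least one diagonally opposite pair of vertices of V. Suppose r < n, i_1, …, i_r ∈ {1,…,n} are distinct indices, V_m ∈ 𝓖_{i_m} for each m ∈ {1,…,r}, k < d, and the number of distinct diagonally opposite pairs of vertices of V that pierce {V_1, …, V_r} is at most 2^k. Then at least one of the following holds: (Option 1) for every diagonally opposite pair (λ, λ') of vertices of V that pierces {V_1, …, V_r} and every i ∈ {1,…,n} \ {i_1,…,i_r}, every B ∈ 𝓖_i satisfies B ∩ {λ, λ'} ≠ ∅; (Option 2) there exist i ∈ {1,…,n} \ {i_1,…,i_r} and V_{r+1} ∈ 𝓖_i such that the number of distinct diagonally opposite pairs of vertices of V that pierce {V_1, …, V_r, V_{r+1}} is at most 2^{k-1}. -/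
/-- `lam` and `lam'` are a diagonally opposite pair of vertices of the box
`∏_j [α j, β j]`. -/
def DiagOpp {d : ℕ} (α β lam lam' : Fin d → ℝ) : Prop :=
  ∀ j, ({lam j, lam' j} : Set ℝ) = {α j, β j}

/-- The set of (unordered) diagonally opposite pairs of vertices of `∏_j [α j, β j]`
that pierce every member of the collection `𝓒`; each pair is recorded as the
two-element set `{lam, lam'}`. -/
def PiercingDiagPairs {d : ℕ} (α β : Fin d → ℝ) (𝓒 : Set (Set (Fin d → ℝ))) :
    Set (Set (Fin d → ℝ)) :=
  {P | ∃ lam lam' : Fin d → ℝ, P = {lam, lam'} ∧ DiagOpp α β lam lam' ∧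
    ∀ B ∈ 𝓒, (B ∩ {lam, lam'}).Nonempty}

/-- Swap the `α` and `β` values of `x` in the coordinates in which `y` and `z` differ. -/
noncomputable def diagFlip {d : ℕ} (α β y z x : Fin d → ℝ) : Fin d → ℝ :=
  fun j => if y j = z j then x j else α j + β j - x j

theorem diagFlip_involutive {d : ℕ} (α β y z : Fin d → ℝ) :
    Function.Involutive (diagFlip α β y z) := by
  intro x
  funext j
  by_cases h : y j = z j <;> simp [diagFlip, h]

theorem DiagOpp.cases {d : ℕ} {α β x x' : Fin d → ℝ} (h : DiagOpp α β x x') (j : Fin d) :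
    (x j = α j ∧ x' j = β j) ∨ (x j = β j ∧ x' j = α j) :=
  Set.pair_eq_pair_iff.1 (h j)

theorem DiagOpp.diagFlip {d : ℕ} {α β x x' : Fin d → ℝ} (h : DiagOpp α β x x')
    (y z : Fin d → ℝ) : DiagOpp α β (diagFlip α β y z x) (diagFlip α β y z x') := by
  intro j
  rw [Set.pair_eq_pair_iff]
  have := h.cases j
  simp only [_root_.diagFlip]
  grind

theorem inter_pair_nonempty_iff {E : Type*} {B : Set E} {x x' : E} :
    (B ∩ {x, x'}).Nonempty ↔ x ∈ B ∨ x' ∈ B := by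
  constructor
  · rintro ⟨u, hu, rfl | rfl⟩
    exacts [Or.inl hu, Or.inr hu]
  · rintro (h | h)
    exacts [⟨x, h, by simp⟩, ⟨x', h, by simp⟩]

/-- The diagonals piercing a box are closed under the ternary operation `diagFlip`. -/
theorem IsBox.pierced_diagFlip {d : ℕ} {α β x x' y y' z z' : Fin d → ℝ}
    {B : Set (Fin d → ℝ)} (hB : IsBox B)
    (hx : DiagOpp α β x x') (hy : DiagOpp α β y y') (hz : DiagOpp α β z z')
    (hxB : (B ∩ {x, x'}).Nonempty) (hyB : (B ∩ {y, y'}).Nonempty)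
    (hzB : (B ∩ {z, z'}).Nonempty) :
    (B ∩ {diagFlip α β y z x, diagFlip α β y z x'}).Nonempty := by
  obtain ⟨a, b, -, rfl⟩ := hB
  rw [inter_pair_nonempty_iff] at *
  simp only [← Set.pi_univ_Icc, Set.mem_univ_pi, Set.mem_Icc, diagFlip] at *
  rcases hxB with h1 | h1 <;> rcases hyB with h2 | h2 <;> rcases hzB with h3 | h3
  on_goal 1 => left
  on_goal 2 => right
  on_goal 3 => right
  on_goal 4 => left
  on_goal 5 => right
  on_goal 6 => left
  on_goal 7 => left
  on_goal 8 => right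
  all_goals
    intro j
    have hxj := hx.cases j
    have hyj := hy.cases j
    have hzj := hz.cases j
    have h1j := h1 j
    have h2j := h2 j
    have h3j := h3 j
    clear h1 h2 h3 hx hy hz
    grind

/-- Flipping back along a flipped pair recovers the third vertex. -/
theorem diagFlip_diagFlip_eq {d : ℕ} {α β x x' y y' z z' : Fin d → ℝ}
    (hx : DiagOpp α β x x') (hy : DiagOpp α β y y') (hz : DiagOpp α β z z') :
    diagFlip α β x (diagFlip α β y z x) y = z ∧
      diagFlip α β x (diagFlip α β y z x) y' = z' := by
  constructor <;> funext j <;>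
  · have hxj := hx.cases j
    have hyj := hy.cases j
    have hzj := hz.cases j
    simp only [diagFlip]
    grind

theorem finite_piercingDiagPairs {d : ℕ} (α β : Fin d → ℝ) (𝓒 : Set (Set (Fin d → ℝ))) :
    (PiercingDiagPairs α β 𝓒).Finite := by
  have hfin : (Set.univ.pi fun j => ({α j, β j} : Set ℝ)).Finite :=
    Set.Finite.pi fun j => Set.toFinite _
  refine hfin.finite_subsets.subset ?_
  rintro P ⟨x, x', rfl, h, -⟩ u hu j -
  change u j ∈ ({α j, β j} : Set ℝ)
  rw [← h j]
  rcases hu with rfl | rfl <;> simp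

/-- If some diagonal pierces a collection of boxes but not one further box, then adding that
box at least halves the number of piercing diagonals. -/
theorem two_mul_ncard_piercingDiagPairs_union_le {d : ℕ} {α β p p' : Fin d → ℝ}
    {𝓒 : Set (Set (Fin d → ℝ))} {B : Set (Fin d → ℝ)} (h𝓒 : ∀ C ∈ 𝓒, IsBox C)
    (hB : IsBox B) (hp : DiagOpp α β p p') (hp𝓒 : ∀ C ∈ 𝓒, (C ∩ {p, p'}).Nonempty)
    (hpB : ¬ (B ∩ {p, p'}).Nonempty) :
    2 * (PiercingDiagPairs α β (𝓒 ∪ {B})).ncard ≤ (PiercingDiagPairs α β 𝓒).ncard := by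
  rcases (PiercingDiagPairs α β (𝓒 ∪ {B})).eq_empty_or_nonempty with h0 | ⟨_, y, y', -, hy, hyC⟩
  · simp only [h0, Set.ncard_empty, mul_zero, zero_le]
  have hinj : Function.Injective (Set.image (diagFlip α β y p)) :=
    Set.image_injective.2 (diagFlip_involutive α β y p).injective
  have hdisj : Disjoint (PiercingDiagPairs α β (𝓒 ∪ {B}))
      (Set.image (diagFlip α β y p) '' PiercingDiagPairs α β (𝓒 ∪ {B})) := by
    rw [Set.disjoint_right]
    rintro _ ⟨_, ⟨x, x', rfl, hx, hxC⟩, rfl⟩ ⟨u, u', hu, -, huC⟩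
    rw [Set.image_pair] at hu
    have huB := huC B (by simp)
    rw [← hu] at huB
    have h := hB.pierced_diagFlip hy hx (hx.diagFlip y p) (hyC B (by simp)) (hxC B (by simp)) huB
    rw [(diagFlip_diagFlip_eq hx hy hp).1, (diagFlip_diagFlip_eq hx hy hp).2] at h
    exact hpB h
  have hsub : PiercingDiagPairs α β (𝓒 ∪ {B}) ∪
      Set.image (diagFlip α β y p) '' PiercingDiagPairs α β (𝓒 ∪ {B}) ⊆
        PiercingDiagPairs α β 𝓒 := by
    rintro _ (⟨x, x', rfl, hx, hxC⟩ | ⟨_, ⟨x, x', rfl, hx, hxC⟩, rfl⟩)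
    · exact ⟨x, x', rfl, hx, fun C hC => hxC C (Or.inl hC)⟩
    · exact ⟨_, _, Set.image_pair _ _ _, hx.diagFlip y p, fun C hC =>
        (h𝓒 C hC).pierced_diagFlip hx hy hp (hxC C (Or.inl hC)) (hyC C (Or.inl hC)) (hp𝓒 C hC)⟩
  have hcard := Set.ncard_le_ncard hsub (finite_piercingDiagPairs α β 𝓒)
  rw [Set.ncard_union_eq hdisj (finite_piercingDiagPairs α β _)
    ((finite_piercingDiagPairs α β _).image _), Set.ncard_image_of_injective _ hinj] at hcard
  lia

/-- Lemma on reducing the choice of piercing diagonals: let `V = ∏_j [α j, β j]` be a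
box and `𝓖 0, …, 𝓖 (n-1)` nonempty families of axis-parallel boxes such that every box
in every family meets `{α j, β j}` in each coordinate `j`, and every colorful `n`-tuple
is pierced by some diagonally opposite pair of vertices of `V`. If `V 0, …, V (r-1)` is
a colorful `r`-tuple (`r < n`, taken from distinct families `𝓖 (ι m)`) pierced by at
most `2 ^ k` distinct diagonally opposite pairs (`k < d`), then either every diagonally
opposite pair piercing the tuple also pierces every family not represented in the tuple
(Option 1), or some family not represented in the tuple contains a box `V'` such that at
most `2 ^ (k - 1)` distinct diagonally opposite pairs pierce the extended tuple
(Option 2). -/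
theorem reducing_choice_of_diagonals (d n : ℕ) (hd : 1 ≤ d)
    (α β : Fin d → ℝ) (hαβ : ∀ j, α j ≤ β j)
    (𝓖 : Fin n → Set (Set (Fin d → ℝ)))
    (hne : ∀ i, (𝓖 i).Nonempty)
    (hbox : ∀ i, ∀ B ∈ 𝓖 i, IsBox B)
    (hvertex : ∀ i, ∀ B ∈ 𝓖 i, ∀ j, ∃ x ∈ B, x j = α j ∨ x j = β j)
    (hcol : ∀ f : Fin n → Set (Fin d → ℝ), (∀ i, f i ∈ 𝓖 i) →
      ∃ lam lam' : Fin d → ℝ, DiagOpp α β lam lam' ∧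
        ∀ i, (f i ∩ {lam, lam'}).Nonempty)
    (r : ℕ) (hr : r < n)
    (ι : Fin r → Fin n) (hι : Function.Injective ι)
    (V : Fin r → Set (Fin d → ℝ)) (hV : ∀ m, V m ∈ 𝓖 (ι m))
    (k : ℕ) (hk : k < d)
    (hcount : (PiercingDiagPairs α β {B | ∃ m, B = V m}).ncard ≤ 2 ^ k) :
    (∀ lam lam' : Fin d → ℝ, DiagOpp α β lam lam' →
        (∀ m, (V m ∩ {lam, lam'}).Nonempty) →
        ∀ i : Fin n, (∀ m, ι m ≠ i) → ∀ B ∈ 𝓖 i, (B ∩ {lam, lam'}).Nonempty) ∨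
    (∃ i : Fin n, (∀ m, ι m ≠ i) ∧ ∃ V' ∈ 𝓖 i,
        (PiercingDiagPairs α β ({B | ∃ m, B = V m} ∪ {V'})).ncard ≤ 2 ^ (k - 1)) := by
  by_contra! hcon
  obtain ⟨⟨p, p', hp, hpV, i, hi, B, hB, hpB⟩, hall⟩ := hcon
  have hhalf := two_mul_ncard_piercingDiagPairs_union_le (𝓒 := {B | ∃ m, B = V m})
    (by rintro _ ⟨m, rfl⟩; exact hbox _ _ (hV m)) (hbox i B hB) hp
    (by rintro _ ⟨m, rfl⟩; exact hpV m) (Set.not_nonempty_iff_eq_empty.2 hpB)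
  have hbig := hall i hi B hB
  cases k with
  | zero => rw [Nat.zero_sub, pow_zero] at hbig; rw [pow_zero] at hcount; lia
  | succ k => rw [Nat.add_sub_cancel] at hbig; rw [pow_succ] at hcount; lia
end

section
/- For every d ≥ 1 and every α ∈ (0,1) there exists β = β(α, d) ∈ (0,1) such that the following holds: for every finite family 𝓕 of axis-parallel boxes in ℝ^d with |𝓕| ≥ 3d, if at least α · C(|𝓕|, 3d) of the 3d-element subsets of 𝓕 are 2-pierceable, then there exists a subfamily 𝓢 ⊆ 𝓕 with |𝓢| ≥ β·|𝓕| that is 2-pierceable. -/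
open Finset in
/-- If some point lies in at least `d + 1` boxes `Icc (a B) (b B)`, then the coordinatewise supremum
of the lower corners of some `d` of them lies in yet another one. -/
lemma exists_iSup_lower_mem {ι : Type*} [DecidableEq ι] {d : ℕ} (hd : 1 ≤ d)
    (a b : ι → Fin d → ℝ) (S : Finset ι) (hS : d < #S) (q : Fin d → ℝ)
    (hq : ∀ B ∈ S, q ∈ Set.Icc (a B) (b B)) :
    ∃ D ⊆ S, #D = d ∧ ∃ x ∈ S \ D,
      (fun j => ⨆ B : D, a B j) ∈ Set.Icc (a x) (b x) := by
  have hne : S.Nonempty := card_pos.mp (by omega)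
  choose g hgS hg using fun j => S.exists_max_image (fun B => a B j) hne
  obtain ⟨D, hgD, hDS, hD⟩ := exists_subsuperset_card_eq (s := univ.image g) (t := S) (n := d)
    (by intro B hB; simp only [mem_image, mem_univ, true_and] at hB; obtain ⟨j, rfl⟩ := hB
        exact hgS j)
    (card_image_le.trans (by simp)) hS.le
  obtain ⟨x, hx⟩ : (S \ D).Nonempty := by
    rw [← card_pos, card_sdiff_of_subset hDS]; omega
  have hxS := (mem_sdiff.mp hx).1
  refine ⟨D, hDS, hD, x, hx, fun j => ?_, fun j => ?_⟩
  · exact (hg j x hxS).trans (le_ciSup (f := fun B : D => a B j) (Set.finite_range _).bddAbove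
      ⟨g j, hgD (mem_image_of_mem g (mem_univ j))⟩)
  · have : Nonempty D := (card_pos.mp (by omega : 0 < #D)).to_subtype
    exact (ciSup_le (f := fun B : D => a B j) fun B => (hq B (hDS B.2)).1 j).trans ((hq x hxS).2 j)

open Finset in
/-- If every member of `𝒯`, a family of `k`-subsets of `F`, contains a `d`-set `D` together with
an element of `N D` outside `D`, then the size of `𝒯` is bounded in terms of the sizes of the
`N D`. -/
lemma card_le_sum_card_mul_choose {ι : Type*} [DecidableEq ι] {d k : ℕ} (F : Finset ι)
    (N : Finset ι → Finset ι) (𝒯 : Finset (Finset ι))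
    (h : ∀ T ∈ 𝒯, T ⊆ F ∧ #T = k ∧ ∃ D ⊆ T, #D = d ∧ ∃ x ∈ T \ D, x ∈ N D) :
    #𝒯 ≤ ∑ D ∈ powersetCard d F, #(N D) * (#F - (d + 1)).choose (k - (d + 1)) := by
  have hsub : 𝒯 ⊆ (powersetCard d F).biUnion fun D => ((N D ∩ F) \ D).biUnion fun x =>
      (powersetCard (k - (d + 1)) (F \ insert x D)).image (insert x D ∪ ·) := by
    intro T hT
    obtain ⟨hTF, hTk, D, hDT, hD, x, hx, hxN⟩ := h T hT
    obtain ⟨hxT, hxD⟩ := mem_sdiff.mp hx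
    have hins : insert x D ⊆ T := insert_subset hxT hDT
    simp only [mem_biUnion, mem_powersetCard, mem_image]
    refine ⟨D, ⟨hDT.trans hTF, hD⟩, x, by simp [hxN, hTF hxT, hxD], T \ insert x D,
      ⟨sdiff_subset_sdiff hTF le_rfl, ?_⟩, union_sdiff_of_subset hins⟩
    rw [card_sdiff_of_subset hins, card_insert_of_notMem hxD, hTk, hD]
  refine (card_le_card hsub).trans (card_biUnion_le.trans (sum_le_sum fun D hD => ?_))
  obtain ⟨hDF, hDc⟩ := mem_powersetCard.mp hD
  refine (card_biUnion_le_card_mul _ _ _ fun x hx => ?_).trans (Nat.mul_le_mul_right _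
    (card_le_card (sdiff_subset.trans inter_subset_left)))
  simp only [mem_sdiff, mem_inter] at hx
  refine card_image_le.trans ?_
  rw [card_powersetCard, card_sdiff_of_subset (insert_subset hx.1.2 hDF),
    card_insert_of_notMem hx.2, hDc]

/-- Double counting: a `3d`-set together with a `d`-subset and one further element of it. -/
lemma choose_three_mul_mul_choose {n d : ℕ} (hd : 1 ≤ d) (hn : 3 * d ≤ n) :
    n.choose (3 * d) * (3 * d).choose d * (2 * d) =
      n.choose d * ((n - d) * (n - (d + 1)).choose (3 * d - (d + 1))) := by
  rw [Nat.choose_mul (hsk := by omega), mul_assoc]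
  obtain ⟨e, rfl⟩ : ∃ e, d = e + 1 := ⟨d - 1, by omega⟩
  obtain ⟨m, hm⟩ : ∃ m, n - (e + 1) = m + 1 := ⟨n - (e + 1) - 1, by omega⟩
  rw [show 3 * (e + 1) - (e + 1) = (2 * e + 1) + 1 by omega, hm,
    show n - (e + 1 + 1) = m by omega, show 3 * (e + 1) - (e + 1 + 1) = 2 * e + 1 by omega,
    Nat.add_one_mul_choose_eq, show 2 * (e + 1) = 2 * e + 1 + 1 by ring]

open Finset in
/-- A `2`-pierceable family of more than `2d` sets has more than `d` members sharing a point. -/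
lemma Pierceable.exists_lt_card {X : Type*} {d : ℕ} {T : Finset (Set X)}
    (hT : Pierceable 2 (T : Set (Set X))) (hd : 2 * d < #T) :
    ∃ S ⊆ T, d < #S ∧ ∃ q, ∀ B ∈ S, q ∈ B := by
  classical
  obtain ⟨P, hP, hTP⟩ := hT
  obtain ⟨B₀, hB₀⟩ := card_pos.mp (by omega : 0 < #T)
  have : Nonempty X := ⟨(hTP B₀ hB₀).choose⟩
  choose! f hfP hf using hTP
  obtain ⟨q, -, hq⟩ := exists_lt_card_fiber_of_mul_lt_card_of_maps_to (s := T) (t := P) (f := f)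
    (fun B hB => hfP B hB) (n := d) ((Nat.mul_le_mul_right d hP).trans_lt hd)
  refine ⟨_, filter_subset _ _, hq, q, fun B hB => ?_⟩
  obtain ⟨hBT, rfl⟩ := mem_filter.mp hB
  exact hf B hBT

/-- Fractional Helly theorem for `2`-piercing of axis-parallel boxes in `ℝ^d`: for every
`α ∈ (0,1)` there is a `β ∈ (0,1)` such that whenever at least an `α` fraction of the
`3d`-element subsets of a finite family `𝓕` of axis-parallel boxes are `2`-pierceable,
some subfamily of size at least `β * |𝓕|` is `2`-pierceable. -/
theorem fractional_helly_boxes_two_piercing (d : ℕ) (hd : 1 ≤ d)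
    (α : ℝ) (hα : α ∈ Set.Ioo (0 : ℝ) 1) :
    ∃ β : ℝ, β ∈ Set.Ioo (0 : ℝ) 1 ∧
      ∀ 𝓕 : Finset (Set (Fin d → ℝ)),
        (∀ B ∈ 𝓕, IsBox B) →
        3 * d ≤ 𝓕.card →
        α * (𝓕.card.choose (3 * d) : ℝ) ≤
          ({T : Finset (Set (Fin d → ℝ)) | T ⊆ 𝓕 ∧ T.card = 3 * d ∧
            Pierceable 2 (↑T : Set (Set (Fin d → ℝ)))}.ncard : ℝ) →
        ∃ 𝓢 : Finset (Set (Fin d → ℝ)), 𝓢 ⊆ 𝓕 ∧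
          β * (𝓕.card : ℝ) ≤ (𝓢.card : ℝ) ∧
          Pierceable 2 (↑𝓢 : Set (Set (Fin d → ℝ))) := by
  classical
  obtain ⟨hα0, hα1⟩ := hα
  set C : ℝ := 3 * d * (3 * d).choose d with hC
  have hd' : (1 : ℝ) ≤ d := by exact_mod_cast hd
  have hch : (1 : ℝ) ≤ (3 * d).choose d := by
    exact_mod_cast Nat.choose_pos (by omega : d ≤ 3 * d)
  have hC1 : 1 ≤ C := by nlinarith
  refine ⟨α / C, ⟨by positivity, (div_le_self hα0.le hC1).trans_lt hα1⟩,
    fun 𝓕 hbox hcard hα => ?_⟩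
  choose! a b hab using hbox
  set p : Finset (Set (Fin d → ℝ)) → Fin d → ℝ := fun D j => ⨆ B : D, a B j with hp
  set N : Finset (Set (Fin d → ℝ)) → Finset (Set (Fin d → ℝ)) :=
    fun D => 𝓕.filter (p D ∈ ·) with hN
  set 𝒯 := 𝓕.powerset.filter fun T : Finset (Set (Fin d → ℝ)) => T.card = 3 * d ∧
    Pierceable 2 (T : Set (Set (Fin d → ℝ))) with h𝒯
  rw [show {T : Finset (Set (Fin d → ℝ)) | T ⊆ 𝓕 ∧ T.card = 3 * d ∧
      Pierceable 2 (T : Set (Set (Fin d → ℝ)))} = (𝒯 : Set _) by ext T; simp [h𝒯],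
    Set.ncard_coe_finset] at hα
  have hcount := card_le_sum_card_mul_choose (d := d) (k := 3 * d) 𝓕 N 𝒯 fun T hT => by
    simp only [h𝒯, Finset.mem_filter, Finset.mem_powerset] at hT
    obtain ⟨hTF, hT3, hTP⟩ := hT
    obtain ⟨S, hST, hS, q, hq⟩ := hTP.exists_lt_card (d := d) (by omega)
    obtain ⟨D, hDS, hD, x, hx, hpx⟩ := exists_iSup_lower_mem hd a b S hS q fun B hB =>
      (hab B (hTF (hST hB))).2 ▸ hq B hB
    obtain ⟨hxS, hxD⟩ := Finset.mem_sdiff.mp hx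
    have hxF := hTF (hST hxS)
    refine ⟨hTF, hT3, D, hDS.trans hST, hD, x, by simp [hST hxS, hxD], ?_⟩
    refine Finset.mem_filter.mpr ⟨hxF, ?_⟩
    rw [(hab x hxF).2]
    exact hpx
  obtain ⟨D, -, hmax⟩ := (𝓕.powersetCard d).exists_max_image (fun D => (N D).card)
    (Finset.powersetCard_nonempty.mpr (by omega))
  refine ⟨N D, Finset.filter_subset _ _, ?_, {p D}, by simp, fun B hB => ⟨p D, by simp, ?_⟩⟩
  swap
  · exact (Finset.mem_filter.mp (Finset.mem_coe.mp hB)).2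
  set n := 𝓕.card with hn
  set c := (n - (d + 1)).choose (3 * d - (d + 1)) with hc
  have hbound : 𝒯.card ≤ n.choose d * ((N D).card * c) := by
    refine hcount.trans ((Finset.sum_le_card_nsmul _ _ _ fun E hE =>
      Nat.mul_le_mul_right c (hmax E hE)).trans ?_)
    simp [hn]
  have hid := choose_three_mul_mul_choose hd hcard
  rw [← hc] at hid
  have hid' : (n.choose (3 * d) : ℝ) * (3 * d).choose d * (2 * d) =
      n.choose d * ((n - d) * c) := by
    rw [← Nat.cast_sub (by omega : d ≤ n)]
    exact_mod_cast hid
  have hbound' : (𝒯.card : ℝ) ≤ n.choose d * ((N D).card * c) := by exact_mod_cast hbound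
  have hpos : (0 : ℝ) < n.choose d * c := by
    exact_mod_cast Nat.mul_pos (Nat.choose_pos (by omega)) (Nat.choose_pos (by omega))
  have hn3 : (3 : ℝ) * d ≤ n := by exact_mod_cast hcard
  have key : α * (n - d) ≤ (N D).card * ((3 * d).choose d * (2 * d)) := by
    refine le_of_mul_le_mul_left ?_ hpos
    calc (n.choose d * c : ℝ) * (α * (n - d))
        = α * n.choose (3 * d) * ((3 * d).choose d * (2 * d)) := by linear_combination -α * hid'
      _ ≤ n.choose d * ((N D).card * c) * ((3 * d).choose d * (2 * d)) := by
          exact mul_le_mul_of_nonneg_right (hα.trans hbound') (by positivity)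
      _ = _ := by ring
  rw [div_mul_eq_mul_div, div_le_iff₀ (by positivity), hC]
  nlinarith
end

section
/- For every n ≥ 1 and every α ∈ (0,1) there exists β = β(α, n) ∈ (0,1) such that the following holds: for every finite family 𝓕 of closed intervals in ℝ with |𝓕| ≥ n+1, if at least α · C(|𝓕|, n+1) of the (n+1)-element subsets of 𝓕 are n-pierceable, then there exists a subfamily 𝓢 ⊆ 𝓕 with |𝓢| ≥ β·|𝓕| that is n-pierceable. -/
open Finset in
/-- Among more than `n` sets pierced by `n` points, two distinct ones intersect. -/
theorem Pierceable.exists_ne_inter_nonempty {X : Type*} {n : ℕ} {T : Finset (Set X)}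
    (hT : Pierceable n (↑T : Set (Set X))) (hcard : n < #T) :
    ∃ I ∈ T, ∃ J ∈ T, I ≠ J ∧ (I ∩ J).Nonempty := by
  obtain ⟨P, hP, h⟩ := hT
  obtain ⟨F, hF⟩ := card_pos.1 (Nat.zero_lt_of_lt hcard)
  have : Nonempty X := ⟨(h F hF).choose⟩
  choose! f hfP hf using h
  obtain ⟨I, hI, J, hJ, hne, hIJ⟩ :=
    exists_ne_map_eq_of_card_lt_of_maps_to (hP.trans_lt hcard) hfP
  exact ⟨I, hI, J, hJ, hne, f I, hf I hI, hIJ ▸ hf J hJ⟩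

/-- If two closed intervals intersect, one of them contains the left endpoint of the other. -/
theorem Set.Icc_inter_nonempty_imp_left_mem {X : Type*} [LinearOrder X] {a b c d : X}
    (h : (Set.Icc a b ∩ Set.Icc c d).Nonempty) : a ∈ Set.Icc c d ∨ c ∈ Set.Icc a b := by
  obtain ⟨x, ⟨hax, hxb⟩, hcx, hxd⟩ := h
  rcases le_total a c with hac | hca
  · exact Or.inr ⟨hac, hcx.trans hxb⟩
  · exact Or.inl ⟨hca, hax.trans hxd⟩

open Finset in
/-- If each element of `s` is `r`-related to at most `D` other elements of `s`, at most
`|s| * D * (|s| - 2).choose k` of the `(k + 2)`-subsets of `s` contain a related pair. -/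
theorem Finset.card_powersetCard_filter_exists_pair_le {ι : Type*} [DecidableEq ι]
    (s : Finset ι) (r : ι → ι → Prop) [DecidableRel r] (k D : ℕ)
    (hD : ∀ i ∈ s, #{j ∈ s | j ≠ i ∧ r i j} ≤ D) (𝓣 : Finset (Finset ι))
    (h𝓣 : ∀ T ∈ 𝓣, T ⊆ s ∧ #T = k + 2 ∧ ∃ i ∈ T, ∃ j ∈ T, j ≠ i ∧ r i j) :
    #𝓣 ≤ #s * (D * (#s - 2).choose k) := by
  have hsub : 𝓣 ⊆ s.biUnion fun i => {j ∈ s | j ≠ i ∧ r i j}.biUnion fun j =>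
      ((s \ {i, j}).powersetCard k).image fun U => U ∪ {i, j} := by
    intro T hT
    obtain ⟨hTs, hcard, i, hi, j, hj, hne, hr⟩ := h𝓣 T hT
    have hij : {i, j} ⊆ T := by simp [insert_subset_iff, hi, hj]
    simp only [mem_biUnion, mem_filter, mem_image, mem_powersetCard]
    refine ⟨i, hTs hi, j, ⟨hTs hj, hne, hr⟩, T \ {i, j},
      ⟨sdiff_subset_sdiff hTs le_rfl, ?_⟩, sdiff_union_of_subset hij⟩
    rw [card_sdiff_of_subset hij, card_pair hne.symm, hcard, Nat.add_sub_cancel]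
  refine (card_le_card hsub).trans (card_biUnion_le_card_mul _ _ _ fun i hi => ?_)
  refine (card_biUnion_le_card_mul _ _ ((#s - 2).choose k) fun j hj => ?_).trans
    (Nat.mul_le_mul_right _ (hD i hi))
  obtain ⟨hj, hne, -⟩ := mem_filter.1 hj
  refine card_image_le.trans_eq ?_
  rw [card_powersetCard, card_sdiff_of_subset (by simp [insert_subset_iff, hi, hj]),
    card_pair hne.symm]

/-- The number of `(k + 2)`-subsets of an `(l + 2)`-set, counted with an ordered pair of
distinct elements. -/
theorem Nat.choose_add_two_mul (l k : ℕ) :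
    (l + 2).choose (k + 2) * ((k + 2) * (k + 1)) = (l + 2) * ((l + 1) * l.choose k) := by
  rw [Nat.add_one_mul_choose_eq l k, ← mul_assoc, ← mul_assoc,
    Nat.add_one_mul_choose_eq (l + 1) (k + 1)]

/-- Fractional Helly theorem for `n`-piercing of closed intervals in `ℝ`: for every
`α ∈ (0,1)` there is a `β ∈ (0,1)` such that whenever at least an `α` fraction of the
`(n+1)`-element subsets of a finite family `𝓕` of closed intervals are `n`-pierceable,
some subfamily of size at least `β * |𝓕|` is `n`-pierceable. -/
theorem fractional_helly_intervals_n_piercing (n : ℕ) (hn : 1 ≤ n)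
    (α : ℝ) (hα : α ∈ Set.Ioo (0 : ℝ) 1) :
    ∃ β : ℝ, β ∈ Set.Ioo (0 : ℝ) 1 ∧
      ∀ 𝓕 : Finset (Set ℝ),
        (∀ I ∈ 𝓕, ∃ a b : ℝ, a ≤ b ∧ I = Set.Icc a b) →
        n + 1 ≤ 𝓕.card →
        α * (𝓕.card.choose (n + 1) : ℝ) ≤
          ({T : Finset (Set ℝ) | T ⊆ 𝓕 ∧ T.card = n + 1 ∧
            Pierceable n (↑T : Set (Set ℝ))}.ncard : ℝ) →
        ∃ 𝓢 : Finset (Set ℝ), 𝓢 ⊆ 𝓕 ∧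
          β * (𝓕.card : ℝ) ≤ (𝓢.card : ℝ) ∧
          Pierceable n (↑𝓢 : Set (Set ℝ)) := by
  classical
  obtain ⟨hα0, hα1⟩ := hα
  obtain ⟨k, rfl⟩ : ∃ k, n = k + 1 := ⟨n - 1, by omega⟩
  have hk : (1 : ℝ) < (k + 2) * (k + 1) := by
    have : (0 : ℝ) ≤ k := k.cast_nonneg
    nlinarith
  refine ⟨α / ((k + 2) * (k + 1)), ⟨by positivity, ?_⟩, fun 𝓕 hIcc hcard hmany => ?_⟩
  · rw [div_lt_one (by positivity)]
    exact hα1.trans hk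
  by_contra! hno
  have hpoint (x : ℝ) : ((𝓕.filter (x ∈ ·)).card : ℝ) < α / ((k + 2) * (k + 1)) * 𝓕.card := by
    by_contra! hx
    exact hno _ (Finset.filter_subset _ _) hx ⟨{x}, by simp, by simp⟩
  -- `D` bounds the number of further members containing the left endpoint of a given member.
  set D := 𝓕.sup fun I => (𝓕.filter fun J => J ≠ I ∧ sInf I ∈ J).card
  have hD : ∀ I ∈ 𝓕, (𝓕.filter fun J => J ≠ I ∧ sInf I ∈ J).card ≤ D :=
    fun I hI => Finset.le_sup (f := fun I => (𝓕.filter fun J => J ≠ I ∧ sInf I ∈ J).card) hI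
  have hD_lt : (D : ℝ) + 1 < α / ((k + 2) * (k + 1)) * 𝓕.card := by
    obtain ⟨I, hI, hDI⟩ := Finset.exists_mem_eq_sup 𝓕 (Finset.card_pos.1 (by omega))
      fun I => (𝓕.filter fun J => J ≠ I ∧ sInf I ∈ J).card
    have hI_mem : sInf I ∈ I := by
      obtain ⟨a, b, hab, rfl⟩ := hIcc I hI
      simpa [csInf_Icc hab] using hab
    have hlt : D < (𝓕.filter (sInf I ∈ ·)).card := by
      refine hDI.trans_lt (Finset.card_lt_card ?_)
      refine Finset.ssubset_iff_subset_ne.2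
        ⟨Finset.monotone_filter_right _ fun J _ hJ => hJ.2, fun heq => ?_⟩
      have hI' : I ∈ 𝓕.filter (sInf I ∈ ·) := Finset.mem_filter.2 ⟨hI, hI_mem⟩
      rw [← heq] at hI'
      simp at hI'
    exact lt_of_le_of_lt (by exact_mod_cast hlt) (hpoint (sInf I))
  have hcount := Finset.card_powersetCard_filter_exists_pair_le 𝓕 (fun I J => sInf I ∈ J) k D hD
    ((𝓕.powersetCard (k + 2)).filter fun T => Pierceable (k + 1) (↑T : Set (Set ℝ))) (by
      intro T hT
      obtain ⟨hT, hpierce⟩ := Finset.mem_filter.1 hT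
      obtain ⟨hTF, hTcard⟩ := Finset.mem_powersetCard.1 hT
      refine ⟨hTF, hTcard, ?_⟩
      obtain ⟨I, hI, J, hJ, hne, hIJ⟩ := hpierce.exists_ne_inter_nonempty (by omega)
      obtain ⟨a, b, hab, rfl⟩ := hIcc I (hTF hI)
      obtain ⟨c, d, hcd, rfl⟩ := hIcc J (hTF hJ)
      rcases Set.Icc_inter_nonempty_imp_left_mem hIJ with h | h
      · exact ⟨_, hI, _, hJ, hne.symm, by rwa [csInf_Icc hab]⟩
      · exact ⟨_, hJ, _, hI, hne, by rwa [csInf_Icc hcd]⟩)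
  rw [← Set.ncard_coe_finset] at hcount
  simp only [Finset.coe_filter, Finset.mem_powersetCard, and_assoc] at hcount
  obtain ⟨l, hl⟩ : ∃ l, 𝓕.card = l + 2 := ⟨𝓕.card - 2, by omega⟩
  rw [hl] at hcount hmany hcard hD_lt
  rw [Nat.add_sub_cancel] at hcount
  have hchoose : (0 : ℝ) < (l + 2) * l.choose k := by
    have := Nat.choose_pos (show k ≤ l by omega)
    positivity
  have hid : ((l + 2).choose (k + 2) : ℝ) * ((k + 2) * (k + 1)) =
      (l + 2) * ((l + 1) * l.choose k) := by
    exact_mod_cast Nat.choose_add_two_mul l k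
  have hle : α * ((l + 2).choose (k + 2) : ℝ) ≤ (l + 2) * (D * l.choose k) :=
    hmany.trans (by exact_mod_cast hcount)
  have hlower : α * (l + 1) ≤ D * ((k + 2) * (k + 1)) := by
    refine le_of_mul_le_mul_right ?_ hchoose
    calc α * (l + 1) * ((l + 2) * l.choose k)
        = α * ((l + 2).choose (k + 2) : ℝ) * ((k + 2) * (k + 1)) := by
          rw [mul_assoc α ((l + 2).choose (k + 2) : ℝ), hid]; ring
      _ ≤ (l + 2) * (D * l.choose k) * ((k + 2) * (k + 1)) := by gcongr
      _ = D * ((k + 2) * (k + 1)) * ((l + 2) * l.choose k) := by ring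
  rw [div_mul_eq_mul_div, lt_div_iff₀ (by positivity)] at hD_lt
  push_cast at hD_lt
  linarith
end
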